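/- arXiv:math/0209252 — 2 statements merged into one kernel-verified Lean document; each statement's English description precedes it below -/
import Mathlib

section
/- Let S be a semigroup having an embeddable *-pair P = (≤_l, ≤_r). Then there exists a semigroup Q containing S as a subsemigroup such that S is a straight (two-sided) order in Q and Q induces P, if and only if P satisfies conditions (Gi), (Gii) and the dual condition (Gii)': for every a ∈ S(S), H'_a is left reversible, i.e. for all x,y ∈ H'_a there exist u,v ∈ H'_a with xu = yv. -/
universe u

variable {Q : Type u}

/-- `p ≤_L q` in a semigroup `Q`: `Q¹p ⊆ Q¹q`, i.e. `p = q` or `p = x*q` for some `x`. -/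
def leL [Semigroup Q] (p q : Q) : Prop := p = q ∨ ∃ x, p = x * q

/-- `p ≤_R q` in a semigroup `Q`: `pQ¹ ⊆ qQ¹`. -/
def leR [Semigroup Q] (p q : Q) : Prop := p = q ∨ ∃ x, p = q * x

/-- Green's relation `L`. -/
def GreenL [Semigroup Q] (p q : Q) : Prop := leL p q ∧ leL q p

/-- Green's relation `R`. -/
def GreenR [Semigroup Q] (p q : Q) : Prop := leR p q ∧ leR q p

/-- Green's relation `H = L ∩ R`. -/
def GreenH [Semigroup Q] (p q : Q) : Prop := GreenL p q ∧ GreenR p q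

/-- Green's relation `D = L ∘ R`. -/
def GreenD [Semigroup Q] (p q : Q) : Prop := ∃ c, GreenL p c ∧ GreenR c q

/-- `h` is the group inverse `q♯` of `q` (in the group `H`-class of `q`):
`q` and `h` commute, `qhq = q` and `hqh = h`.  This holds precisely when `q` lies in a
subgroup of `Q` and `h` is its group inverse there. -/
def IsGroupInverse [Semigroup Q] (q h : Q) : Prop :=
  q * h = h * q ∧ q * h * q = q ∧ h * q * h = h

/-- `q` lies in a subgroup of `Q` (i.e. `q ∈ H(Q)`, the `H`-class of `q` is a group). -/
def inSubgroup [Semigroup Q] (q : Q) : Prop := ∃ h, IsGroupInverse q h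

/-- A semigroup is regular if every element `q` can be written `q = qxq`. -/
def Regular (Q : Type u) [Semigroup Q] : Prop := ∀ q : Q, ∃ x, q * x * q = q

variable {S : Type u}

/-- `a ≤_{L*} b` in a semigroup `S`: for all `x, y ∈ S¹`, `bx = by` implies `ax = ay`. -/
def leLstar [Semigroup S] (a b : S) : Prop :=
  ∀ x y : WithOne S, (b : WithOne S) * x = (b : WithOne S) * y →
    (a : WithOne S) * x = (a : WithOne S) * y

/-- `a ≤_{R*} b` in a semigroup `S`: for all `x, y ∈ S¹`, `xb = yb` implies `xa = ya`. -/
def leRstar [Semigroup S] (a b : S) : Prop :=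
  ∀ x y : WithOne S, x * (b : WithOne S) = y * (b : WithOne S) →
    x * (a : WithOne S) = y * (a : WithOne S)

/-- `a` is square cancellable: `a H* a²`, i.e. `a L* a²` and `a R* a²`. -/
def SqC [Semigroup S] (a : S) : Prop :=
  leLstar a (a * a) ∧ leLstar (a * a) a ∧ leRstar a (a * a) ∧ leRstar (a * a) a

/-- `S(S)`, the set of square cancellable elements of `S`. -/
def SqSet (S : Type u) [Semigroup S] : Set S := { a | SqC a }

/-- `(lel, ler)` is a `*`-pair for `S`: both are preorders, `lel` is right compatible
with multiplication, `ler` is left compatible, `lel ⊆ ≤_{L*}` and `ler ⊆ ≤_{R*}`. -/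
def IsStarPair [Semigroup S] (lel ler : S → S → Prop) : Prop :=
  (∀ a, lel a a) ∧ (∀ a b c, lel a b → lel b c → lel a c) ∧
  (∀ a, ler a a) ∧ (∀ a b c, ler a b → ler b c → ler a c) ∧
  (∀ a b c, lel a b → lel (a * c) (b * c)) ∧
  (∀ a b c, ler a b → ler (c * a) (c * b)) ∧
  (∀ a b, lel a b → leLstar a b) ∧
  (∀ a b, ler a b → leRstar a b)

/-- The equivalence `L'` associated with `lel`. -/
def Lp [Semigroup S] (lel : S → S → Prop) (a b : S) : Prop := lel a b ∧ lel b a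

/-- The equivalence `R'` associated with `ler`. -/
def Rp [Semigroup S] (ler : S → S → Prop) (a b : S) : Prop := ler a b ∧ ler b a

/-- `H' = L' ∩ R'`. -/
def Hp [Semigroup S] (lel ler : S → S → Prop) (a b : S) : Prop :=
  Lp lel a b ∧ Rp ler a b

/-- `G(S) = { a ∈ S : a H' a² }`. -/
def GS [Semigroup S] (lel ler : S → S → Prop) : Set S := { a | Hp lel ler a (a * a) }

/-- Condition (Ei): `L' ∘ R' = R' ∘ L'`. -/
def CondEi [Semigroup S] (lel ler : S → S → Prop) : Prop :=
  ∀ a b : S, (∃ c, Lp lel a c ∧ Rp ler c b) ↔ (∃ c, Rp ler a c ∧ Lp lel c b)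

/-- Condition (Eii)(l): `b ≤_l c` iff `b L' dc` for some `d ∈ S`. -/
def CondEiiL [Semigroup S] (lel : S → S → Prop) : Prop :=
  ∀ b c : S, lel b c ↔ ∃ d, Lp lel b (d * c)

/-- Condition (Eii)(r): `b ≤_r c` iff `b R' cd` for some `d ∈ S`. -/
def CondEiiR [Semigroup S] (ler : S → S → Prop) : Prop :=
  ∀ b c : S, ler b c ↔ ∃ d, Rp ler b (c * d)

/-- Condition (Eiii): every `L'`-class and every `R'`-class contains an element of
`G(S)`. -/
def CondEiii [Semigroup S] (lel ler : S → S → Prop) : Prop :=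
  (∀ a : S, ∃ g ∈ GS lel ler, Lp lel a g) ∧ (∀ a : S, ∃ g ∈ GS lel ler, Rp ler a g)

/-- Condition (Ev)(l): for `a ∈ G(S)` and `b ∈ S`, `b ≤_l a` implies `ba R' b`. -/
def CondEvL [Semigroup S] (lel ler : S → S → Prop) : Prop :=
  ∀ a ∈ GS lel ler, ∀ b : S, lel b a → Rp ler (b * a) b

/-- Condition (Ev)(r): for `a ∈ G(S)` and `b ∈ S`, `b ≤_r a` implies `ab L' b`. -/
def CondEvR [Semigroup S] (lel ler : S → S → Prop) : Prop :=
  ∀ a ∈ GS lel ler, ∀ b : S, ler b a → Lp lel (a * b) b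

/-- Condition (Evi)(l): for `a ∈ G(S)`, `b, c ≤_l a` and `ba = ca` imply `b = c`. -/
def CondEviL [Semigroup S] (lel ler : S → S → Prop) : Prop :=
  ∀ a ∈ GS lel ler, ∀ b c : S, lel b a → lel c a → b * a = c * a → b = c

/-- Condition (Evi)(r): for `a ∈ G(S)`, `b, c ≤_r a` and `ab = ac` imply `b = c`. -/
def CondEviR [Semigroup S] (lel ler : S → S → Prop) : Prop :=
  ∀ a ∈ GS lel ler, ∀ b c : S, ler b a → ler c a → a * b = a * c → b = c

/-- Condition (Evii)(l): for `a ∈ G(S)`, `b, c ≤_l a` and `ba L' ca` imply `b L' c`. -/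
def CondEviiL [Semigroup S] (lel ler : S → S → Prop) : Prop :=
  ∀ a ∈ GS lel ler, ∀ b c : S, lel b a → lel c a → Lp lel (b * a) (c * a) → Lp lel b c

/-- Condition (Evii)(r): for `a ∈ G(S)`, `b, c ≤_r a` and `ab R' ac` imply `b R' c`. -/
def CondEviiR [Semigroup S] (lel ler : S → S → Prop) : Prop :=
  ∀ a ∈ GS lel ler, ∀ b c : S, ler b a → ler c a → Rp ler (a * b) (a * c) → Rp ler b c

/-- An embeddable `*`-pair: a `*`-pair satisfying (Ei), (Eii), (Eiii), (Ev), (Evi) and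
(Evii) (left and right versions). -/
def IsEmbeddableStarPair [Semigroup S] (lel ler : S → S → Prop) : Prop :=
  IsStarPair lel ler ∧ CondEi lel ler ∧ CondEiiL lel ∧ CondEiiR ler ∧
  CondEiii lel ler ∧ CondEvL lel ler ∧ CondEvR lel ler ∧
  CondEviL lel ler ∧ CondEviR lel ler ∧ CondEviiL lel ler ∧ CondEviiR lel ler

/-- Condition (Gi): `S(S) = G(S)`. -/
def CondGi [Semigroup S] (lel ler : S → S → Prop) : Prop := SqSet S = GS lel ler

/-- Condition (Gii): for every square cancellable `a`, the `H'`-class of `a` is right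
reversible: for all `x, y H' a` there exist `u, v H' a` with `ux = vy`. -/
def CondGii [Semigroup S] (lel ler : S → S → Prop) : Prop :=
  ∀ a ∈ SqSet S, ∀ x y : S, Hp lel ler x a → Hp lel ler y a →
    ∃ u v : S, Hp lel ler u a ∧ Hp lel ler v a ∧ u * x = v * y

/-- Condition (Gii)': for every square cancellable `a`, the `H'`-class of `a` is left
reversible: for all `x, y H' a` there exist `u, v H' a` with `xu = yv`. -/
def CondGii' [Semigroup S] (lel ler : S → S → Prop) : Prop :=
  ∀ a ∈ SqSet S, ∀ x y : S, Hp lel ler x a → Hp lel ler y a →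
    ∃ u v : S, Hp lel ler u a ∧ Hp lel ler v a ∧ x * u = y * v

/-- `Q` (a semigroup) together with the injective multiplicative embedding `f` realises
`S` as a subsemigroup of `Q` which is a straight left order in `Q`, and `Q` induces the
`*`-pair `(lel, ler)` on `S`: (a) every element of `Q` is `a♯ * b` with `a, b ∈ S` and
`a R b` in `Q`; (b) every square cancellable element of `S` lies in a subgroup of `Q`;
(c) for `b, c ∈ S`, `b ≤_l c` iff `b ≤_L c` in `Q`, and `b ≤_r c` iff `b ≤_R c` in
`Q`. -/
def StraightLeftOrderExtension [Semigroup S] (lel ler : S → S → Prop)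
    (Q : Type u) [Semigroup Q] (f : S → Q) : Prop :=
  Function.Injective f ∧ (∀ a b : S, f (a * b) = f a * f b) ∧
  (∀ q : Q, ∃ a b : S, (∃ c, IsGroupInverse (f a) c ∧ q = c * f b) ∧ GreenR (f a) (f b)) ∧
  (∀ a : S, SqC a → inSubgroup (f a)) ∧
  (∀ b c : S, (lel b c ↔ leL (f b) (f c)) ∧ (ler b c ↔ leR (f b) (f c)))

/-- As in `StraightLeftOrderExtension`, but `S` is moreover a straight right order in
`Q`: every element of `Q` is `b * a♯` with `a, b ∈ S` and `a L b` in `Q`. -/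
def StraightOrderExtension [Semigroup S] (lel ler : S → S → Prop)
    (Q : Type u) [Semigroup Q] (f : S → Q) : Prop :=
  StraightLeftOrderExtension lel ler Q f ∧
  (∀ q : Q, ∃ a b : S, (∃ c, IsGroupInverse (f a) c ∧ q = f b * c) ∧ GreenL (f a) (f b))

/-- The elementwise content of an embeddable `*`-pair, in a form which is visibly
self-dual. -/
structure EmbPair {S : Type u} [Semigroup S] (l r : S → S → Prop) : Prop where
  lrefl : ∀ a, l a a
  ltrans : ∀ {a b c}, l a b → l b c → l a c
  rrefl : ∀ a, r a a
  rtrans : ∀ {a b c}, r a b → r b c → r a c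
  lmul : ∀ {a b} c, l a b → l (a * c) (b * c)
  rmul : ∀ {a b} c, r a b → r (c * a) (c * b)
  lcancel : ∀ {a b x y}, l a b → b * x = b * y → a * x = a * y
  rcancel : ∀ {a b x y}, r a b → x * b = y * b → x * a = y * a
  ei : ∀ {a c b}, Lp l a c → Rp r c b → ∃ d, Rp r a d ∧ Lp l d b
  ei' : ∀ {a c b}, Rp r a c → Lp l c b → ∃ d, Lp l a d ∧ Rp r d b
  lmem : ∀ d c, l (d * c) c
  rmem : ∀ c d, r (c * d) c
  lex : ∀ {b c}, l b c → ∃ d, Lp l b (d * c)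
  rex : ∀ {b c}, r b c → ∃ d, Rp r b (c * d)
  gl : ∀ a, ∃ g ∈ GS l r, Lp l a g
  gr : ∀ a, ∃ g ∈ GS l r, Rp r a g
  evl : ∀ {a b}, a ∈ GS l r → l b a → Rp r (b * a) b
  evr : ∀ {a b}, a ∈ GS l r → r b a → Lp l (a * b) b
  evil : ∀ {a b c}, a ∈ GS l r → l b a → l c a → b * a = c * a → b = c
  evir : ∀ {a b c}, a ∈ GS l r → r b a → r c a → a * b = a * c → b = c
  eviil : ∀ {a b c}, a ∈ GS l r → l b a → l c a → Lp l (b * a) (c * a) → Lp l b c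
  eviir : ∀ {a b c}, a ∈ GS l r → r b a → r c a → Rp r (a * b) (a * c) → Rp r b c

/-- Every `H'`-class of an element of `G(S)` is right reversible. -/
def RightReversible {S : Type u} [Semigroup S] (l r : S → S → Prop) : Prop :=
  ∀ a ∈ GS l r, ∀ x y : S, Hp l r x a → Hp l r y a →
    ∃ u v : S, Hp l r u a ∧ Hp l r v a ∧ u * x = v * y

/-- Every `H'`-class of an element of `G(S)` is left reversible. -/
def LeftReversible {S : Type u} [Semigroup S] (l r : S → S → Prop) : Prop :=
  ∀ a ∈ GS l r, ∀ x y : S, Hp l r x a → Hp l r y a →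
    ∃ u v : S, Hp l r u a ∧ Hp l r v a ∧ x * u = y * v

/-- A preorder on `S` regarded as a preorder on the opposite semigroup. -/
def opRel {S : Type u} (l : S → S → Prop) : Sᵐᵒᵖ → Sᵐᵒᵖ → Prop :=
  fun a b => l a.unop b.unop

theorem IsEmbeddableStarPair.embPair {S : Type u} [Semigroup S] {l r : S → S → Prop}
    (h : IsEmbeddableStarPair l r) : EmbPair l r := by
  obtain ⟨⟨h1, h2, h3, h4, h5, h6, h7, h8⟩, ei, el, er, ⟨gl, gr⟩, a1, a2, a3, a4, a5, a6⟩ := h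
  refine
    { lrefl := h1, ltrans := h2 _ _ _, rrefl := h3, rtrans := h4 _ _ _,
      lmul := fun c => h5 _ _ c, rmul := fun c => h6 _ _ c, lcancel := ?_, rcancel := ?_,
      ei := fun {a c b} p q => (ei a b).1 ⟨c, p, q⟩
      ei' := fun {a c b} p q => (ei a b).2 ⟨c, p, q⟩
      lmem := fun d c => (el _ _).2 ⟨d, h1 _, h1 _⟩
      rmem := fun c d => (er _ _).2 ⟨d, h3 _, h3 _⟩
      lex := (el _ _).1, rex := (er _ _).1, gl := gl, gr := gr,
      evl := fun p => a1 _ p _, evr := fun p => a2 _ p _,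
      evil := fun p => a3 _ p _ _, evir := fun p => a4 _ p _ _,
      eviil := fun p => a5 _ p _ _, eviir := fun p => a6 _ p _ _ }
  · intro a b x y hab e
    have := h7 a b hab x y (by exact_mod_cast e)
    exact_mod_cast this
  · intro a b x y hab e
    have := h8 a b hab x y (by exact_mod_cast e)
    exact_mod_cast this

section EmbPairLemmas

variable {l r : S → S → Prop}

theorem hp_op [Semigroup S] {a b : S} (h : Hp l r a b) :
    Hp (opRel r) (opRel l) (MulOpposite.op a) (MulOpposite.op b) := ⟨h.2, h.1⟩

theorem hp_unop [Semigroup S] {a b : Sᵐᵒᵖ} (h : Hp (opRel r) (opRel l) a b) :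
    Hp l r a.unop b.unop := ⟨h.2, h.1⟩

theorem mem_GS_op [Semigroup S] {a : S} (h : a ∈ GS l r) :
    MulOpposite.op a ∈ GS (opRel r) (opRel l) := ⟨h.2, h.1⟩

theorem mem_GS_unop [Semigroup S] {a : Sᵐᵒᵖ} (h : a ∈ GS (opRel r) (opRel l)) :
    a.unop ∈ GS l r := ⟨h.2, h.1⟩

theorem LeftReversible.op [Semigroup S] (h : LeftReversible l r) :
    RightReversible (opRel r) (opRel l) := by
  intro a ha x y hx hy
  obtain ⟨u, v, hu, hv, e⟩ := h _ (mem_GS_unop ha) _ _ (hp_unop hx) (hp_unop hy)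
  exact ⟨.op u, .op v, hp_op hu, hp_op hv, congrArg MulOpposite.op e⟩

theorem RightReversible.of_op [Semigroup S] (h : RightReversible (opRel r) (opRel l)) :
    LeftReversible l r := by
  intro a ha x y hx hy
  obtain ⟨u, v, hu, hv, e⟩ := h _ (mem_GS_op ha) _ _ (hp_op hx) (hp_op hy)
  exact ⟨u.unop, v.unop, hp_unop hu, hp_unop hv, congrArg MulOpposite.unop e⟩

namespace EmbPair

variable [Semigroup S]

theorem op (h : EmbPair l r) : EmbPair (opRel r) (opRel l) where
  lrefl _ := h.rrefl _
  ltrans p q := h.rtrans p q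
  rrefl _ := h.lrefl _
  rtrans p q := h.ltrans p q
  lmul _ p := h.rmul _ p
  rmul _ p := h.lmul _ p
  lcancel p q := congrArg MulOpposite.op (h.rcancel p (congrArg MulOpposite.unop q))
  rcancel p q := congrArg MulOpposite.op (h.lcancel p (congrArg MulOpposite.unop q))
  ei p q := by
    obtain ⟨d, h1, h2⟩ := h.ei' p q
    exact ⟨.op d, h1, h2⟩
  ei' p q := by
    obtain ⟨d, h1, h2⟩ := h.ei p q
    exact ⟨.op d, h1, h2⟩
  lmem _ _ := h.rmem _ _
  rmem _ _ := h.lmem _ _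
  lex p := by
    obtain ⟨d, h1⟩ := h.rex p
    exact ⟨.op d, h1⟩
  rex p := by
    obtain ⟨d, h1⟩ := h.lex p
    exact ⟨.op d, h1⟩
  gl a := by
    obtain ⟨g, h1, h2⟩ := h.gr a.unop
    exact ⟨.op g, mem_GS_op h1, h2⟩
  gr a := by
    obtain ⟨g, h1, h2⟩ := h.gl a.unop
    exact ⟨.op g, mem_GS_op h1, h2⟩
  evl p q := h.evr (mem_GS_unop p) q
  evr p q := h.evl (mem_GS_unop p) q
  evil p q s e := congrArg MulOpposite.op
    (h.evir (mem_GS_unop p) q s (congrArg MulOpposite.unop e))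
  evir p q s e := congrArg MulOpposite.op
    (h.evil (mem_GS_unop p) q s (congrArg MulOpposite.unop e))
  eviil p q s e := h.eviir (mem_GS_unop p) q s e
  eviir p q s e := h.eviil (mem_GS_unop p) q s e

theorem Lrefl (h : EmbPair l r) (a : S) : Lp l a a := ⟨h.lrefl a, h.lrefl a⟩

theorem Rrefl (h : EmbPair l r) (a : S) : Rp r a a := ⟨h.rrefl a, h.rrefl a⟩

theorem Hrefl (h : EmbPair l r) (a : S) : Hp l r a a := ⟨h.Lrefl a, h.Rrefl a⟩

theorem Ltrans (h : EmbPair l r) {a b c : S} (p : Lp l a b) (q : Lp l b c) : Lp l a c :=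
  ⟨h.ltrans p.1 q.1, h.ltrans q.2 p.2⟩

theorem Rtrans (h : EmbPair l r) {a b c : S} (p : Rp r a b) (q : Rp r b c) : Rp r a c :=
  ⟨h.rtrans p.1 q.1, h.rtrans q.2 p.2⟩

theorem Htrans (h : EmbPair l r) {a b c : S} (p : Hp l r a b) (q : Hp l r b c) : Hp l r a c :=
  ⟨h.Ltrans p.1 q.1, h.Rtrans p.2 q.2⟩

theorem Hsymm (_ : EmbPair l r) {a b : S} (p : Hp l r a b) : Hp l r b a :=
  ⟨p.1.symm, p.2.symm⟩

theorem Lmul (h : EmbPair l r) {a b : S} (c : S) (p : Lp l a b) : Lp l (a * c) (b * c) :=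
  ⟨h.lmul c p.1, h.lmul c p.2⟩

theorem Rmul (h : EmbPair l r) {a b : S} (c : S) (p : Rp r a b) : Rp r (c * a) (c * b) :=
  ⟨h.rmul c p.1, h.rmul c p.2⟩

/-- If `x` is `L'`-related to an element `g` of `G(S)` with `y R' g`, then
`x y L' y` and `x y R' x`. -/
theorem mul_of_mem_GS (h : EmbPair l r) {g x y : S} (hg : g ∈ GS l r) (hx : Lp l x g)
    (hy : Rp r y g) : Lp l (x * y) y ∧ Rp r (x * y) x :=
  ⟨h.Ltrans (h.Lmul y hx) (h.evr hg hy.1), h.Rtrans (h.Rmul x hy) (h.evl hg hx.1)⟩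

theorem H_mul (h : EmbPair l r) {a x y : S} (ha : a ∈ GS l r) (hx : Hp l r x a)
    (hy : Hp l r y a) : Hp l r (x * y) a :=
  have := h.mul_of_mem_GS ha hx.1 hy.2
  ⟨h.Ltrans this.1 hy.1, h.Rtrans this.2 hx.2⟩

theorem mem_GS_of_H (h : EmbPair l r) {a x : S} (ha : a ∈ GS l r) (hx : Hp l r x a) :
    x ∈ GS l r := h.Htrans hx (h.Hsymm (h.H_mul ha hx hx))

/-- Right multiplication by a suitable `y` maps the `H'`-class of `x` into `H'_g`,
for `g ∈ G(S)` with `x R' g`. -/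
theorem exists_mul_H (h : EmbPair l r) {g x : S} (hg : Rp r x g) :
    ∃ y k, k ∈ GS l r ∧ Lp l x k ∧ Rp r y k ∧ ∀ x', Hp l r x' x → Hp l r (x' * y) g := by
  obtain ⟨k, hk, hxk⟩ := h.gl x
  obtain ⟨y, hy1, hy2⟩ := h.ei' hg.symm hxk
  refine ⟨y, k, hk, hxk, hy2, fun x' hx' => ?_⟩
  have := h.mul_of_mem_GS hk (h.Ltrans hx'.1 hxk) hy2
  exact ⟨h.Ltrans this.1 hy1.symm, h.Rtrans this.2 (h.Rtrans hx'.2 hg)⟩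

theorem exists_mul_eq_mul (h : EmbPair l r) (hrev : RightReversible l r) {g x x' : S}
    (hg : g ∈ GS l r) (hx : Rp r x g) (hx' : Hp l r x' x) :
    ∃ u v, Hp l r u g ∧ Hp l r v g ∧ u * x = v * x' := by
  obtain ⟨y, k, hk, hxk, hy, H⟩ := h.exists_mul_H hx
  obtain ⟨u, v, hu, hv, e⟩ := hrev g hg _ _ (H x (h.Hrefl x)) (H x' hx')
  refine ⟨u, v, hu, hv, h.evil hk (h.ltrans (h.lmem u x) hxk.1)
    (h.ltrans (h.lmem v x') (h.ltrans hx'.1.1 hxk.1)) (h.rcancel hy.2 ?_)⟩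
  rw [mul_assoc, e, mul_assoc]

/-- The left Ore condition: `x c♯ = u♯ v`. -/
theorem left_ore (h : EmbPair l r) (hrev : RightReversible l r) {g c x : S}
    (hg : g ∈ GS l r) (hx : Rp r x g) (hc : c ∈ GS l r) (hxc : l x c) :
    ∃ u v, Hp l r u g ∧ Rp r v g ∧ l v c ∧ u * x = v * c := by
  obtain ⟨d, hd⟩ := h.lex (h.ltrans hxc hc.1.1)
  rw [← mul_assoc] at hd
  obtain ⟨w, hw1, hw2⟩ := h.ei hd (h.evl hc (h.lmem d c))
  have hwc : l w c := h.ltrans hw2.1 (h.lmem d c)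
  have hH : Hp l r (w * c) x :=
    ⟨h.Ltrans (h.Lmul c hw2) hd.symm, h.Rtrans (h.evl hc hwc) hw1.symm⟩
  obtain ⟨u, v, hu, hv, e⟩ := h.exists_mul_eq_mul hrev hg hx hH
  refine ⟨u, v * w, hu, ?_, h.ltrans (h.lmem v w) hwc, by rw [e, mul_assoc]⟩
  have hwg : Rp r w g := h.Rtrans hw1.symm hx
  exact h.Rtrans (h.Rmul v hwg) (h.H_mul hg hv (h.Hrefl g)).2

end EmbPair

end EmbPairLemmas

/-- Binary relations on a type, as a semigroup under composition. -/
def RelSemigroup (X : Type u) : Type u := X → X → Prop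

namespace RelSemigroup

variable {X : Type u}

instance : Semigroup (RelSemigroup X) where
  mul q p := Relation.Comp q p
  mul_assoc _ _ _ := Relation.comp_assoc

theorem mul_apply (q p : RelSemigroup X) (x z : X) : (q * p) x z ↔ ∃ y, q x y ∧ p y z :=
  Iff.rfl

theorem ext {q p : RelSemigroup X} (h : ∀ x z, q x z ↔ p x z) : q = p :=
  funext fun x => funext fun z => propext (h x z)

end RelSemigroup

theorem isGroupInverse_of_eqs [Semigroup Q] {p b : Q} (h1 : p * b * p = p)
    (h2 : p * p * b = p) (h3 : b * b * p = b) : IsGroupInverse p (p * b * b) := by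
  have h4 : p * b * b * p = p * b := by rw [mul_assoc, mul_assoc, ← mul_assoc b, h3]
  have h5 : p * (p * b * b) = p * b := by rw [← mul_assoc, ← mul_assoc, h2]
  refine ⟨by rw [h4, h5], by rw [h5, h1], ?_⟩
  rw [h4, ← mul_assoc, ← mul_assoc, h1]

/-- A right `S`-act `X` with distinguished parts `V` (the support of the partial action) and
`U c` (the part on which `c` acts bijectively), suited to a partial representation of `S` in
which the elements of `G(S)` act as elements of subgroups. -/
structure PartialRep {S : Type u} [Semigroup S] (l r : S → S → Prop) (X : Type u) where
  /-- The action. -/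
  act : X → S → X
  /-- The support of the partial action. -/
  V : X → Prop
  /-- The part on which `c` acts bijectively. -/
  U : S → X → Prop
  act_act : ∀ z s t, act (act z s) t = act z (s * t)
  V_of_act : ∀ {z s}, V (act z s) → V z
  U_act : ∀ {b c} z, l b c → U c (act z b)
  inj : ∀ {c z w}, c ∈ GS l r → U c z → U c w → act z c = act w c → z = w
  act_eq : ∀ {b c z w}, r b c → act z c = act w c → act z b = act w b
  V_mono : ∀ {b c z}, r b c → V (act z b) → V (act z c)
  V_act : ∀ {c z}, c ∈ GS l r → V z → U c z → V (act z c)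
  surj : ∀ {c z}, c ∈ GS l r → V z → U c z → ∃ w, U c w ∧ act w c = z
  reflects : ∀ b, ∃ z, V (act z b) ∧ (∀ c w, act w c = act z b → l b c) ∧
    ∀ c, r b c → r c b → act z b = act z c → b = c

namespace PartialRep

variable [Semigroup S] {l r : S → S → Prop} {X : Type u} (P : PartialRep l r X)

/-- The partial map by which `s` acts. -/
def rho (s : S) : RelSemigroup X := fun z w => P.V w ∧ w = P.act z s

/-- The inverse of the restriction to `U c` of the partial map by which `c` acts. -/
def rhoInv (c : S) : RelSemigroup X := fun z w => P.V z ∧ P.U c w ∧ P.act w c = z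

/-- The group inverse of `rho c`, for `c ∈ G(S)`. -/
def sharp (c : S) : RelSemigroup X := P.rho c * P.rhoInv c * P.rhoInv c

theorem rho_mul (s t : S) : P.rho (s * t) = P.rho s * P.rho t := by
  refine RelSemigroup.ext fun z w => ?_
  rw [RelSemigroup.mul_apply]
  constructor
  · rintro ⟨hV, rfl⟩
    rw [← P.act_act] at hV ⊢
    exact ⟨_, ⟨P.V_of_act hV, rfl⟩, hV, rfl⟩
  · rintro ⟨_, ⟨_, rfl⟩, hV, rfl⟩
    exact ⟨hV, P.act_act _ _ _⟩

theorem rho_rho_rhoInv {b c : S} (hc : c ∈ GS l r) (hb : l b c) :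
    P.rho b * P.rho c * P.rhoInv c = P.rho b := by
  refine RelSemigroup.ext fun z w => ?_
  constructor
  · rintro ⟨_, ⟨_, ⟨hV, rfl⟩, _, rfl⟩, _, hU, e⟩
    obtain rfl := P.inj hc hU (P.U_act z hb) e
    exact ⟨hV, rfl⟩
  · rintro ⟨hV, rfl⟩
    have hU := P.U_act z hb
    have := P.V_act hc hV hU
    exact ⟨_, ⟨_, ⟨hV, rfl⟩, this, rfl⟩, this, hU, rfl⟩

theorem rho_rhoInv_rho {b c : S} (hl : ∀ a, l a a) (hc : c ∈ GS l r) (hb : r b c) :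
    P.rho c * P.rhoInv c * P.rho b = P.rho b := by
  refine RelSemigroup.ext fun z w => ?_
  constructor
  · rintro ⟨_, ⟨_, ⟨_, rfl⟩, _, _, e⟩, hV, rfl⟩
    exact ⟨hV, P.act_eq hb e⟩
  · rintro ⟨hV, rfl⟩
    have hV' := P.V_mono hb hV
    obtain ⟨w, hU, e⟩ := P.surj hc hV' (P.U_act z (hl c))
    exact ⟨_, ⟨_, ⟨hV', rfl⟩, hV', hU, e⟩, hV, (P.act_eq hb e).symm⟩

theorem rhoInv_rhoInv_rho {c : S} (hl : ∀ a, l a a) (hc : c ∈ GS l r) :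
    P.rhoInv c * P.rhoInv c * P.rho c = P.rhoInv c := by
  refine RelSemigroup.ext fun z w => ?_
  constructor
  · rintro ⟨_, ⟨_, ⟨hV, _, e⟩, _, _, rfl⟩, _, rfl⟩
    exact ⟨hV, P.U_act _ (hl c), e⟩
  · rintro ⟨hV, hU, rfl⟩
    have hV' := P.V_of_act hV
    obtain ⟨y, hy, rfl⟩ := P.surj hc hV' hU
    exact ⟨_, ⟨_, ⟨hV, hU, rfl⟩, hV', hy, rfl⟩, hV', rfl⟩

theorem isGroupInverse_sharp {c : S} (hl : ∀ a, l a a) (hr : ∀ a, r a a) (hc : c ∈ GS l r) :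
    IsGroupInverse (P.rho c) (P.sharp c) :=
  isGroupInverse_of_eqs (P.rho_rhoInv_rho hl hc (hr c)) (P.rho_rho_rhoInv hc (hl c))
    (P.rhoInv_rhoInv_rho hl hc)

theorem rho_mul_sharp {c : S} (hl : ∀ a, l a a) (hc : c ∈ GS l r) :
    P.rho c * P.sharp c = P.rho c * P.rhoInv c := by
  rw [sharp, ← mul_assoc, ← mul_assoc, P.rho_rho_rhoInv hc (hl c)]

end PartialRep

/-- A homomorphism `φ` from `S` together with group inverses `i a` of the images of the elements
`a` of `G(S)`, such that the idempotents `φ a * i a` act as identities on the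
images of the elements below `a`. -/
structure GroupRep {S : Type u} [Semigroup S] (l r : S → S → Prop) {T : Type u} [Semigroup T]
    (φ i : S → T) : Prop where
  map_mul : ∀ s t, φ (s * t) = φ s * φ t
  inv : ∀ {c}, c ∈ GS l r → IsGroupInverse (φ c) (i c)
  mul_idem : ∀ {b c}, c ∈ GS l r → l b c → φ b * (φ c * i c) = φ b
  idem_mul : ∀ {b c}, c ∈ GS l r → r b c → φ c * i c * φ b = φ b

theorem PartialRep.groupRep [Semigroup S] {l r : S → S → Prop} {X : Type u}
    (P : PartialRep l r X) (hl : ∀ a, l a a) (hr : ∀ a, r a a) :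
    GroupRep l r P.rho P.sharp where
  map_mul := P.rho_mul
  inv := P.isGroupInverse_sharp hl hr
  mul_idem hc hb := by rw [P.rho_mul_sharp hl hc, ← mul_assoc, P.rho_rho_rhoInv hc hb]
  idem_mul hc hb := by rw [P.rho_mul_sharp hl hc, P.rho_rhoInv_rho hl hc hb]

theorem PartialRep.le_of_leL [Semigroup S] {l r : S → S → Prop} {X : Type u}
    (P : PartialRep l r X) {b c : S} (h : leL (P.rho b) (P.rho c)) : l b c := by
  obtain ⟨z, hV, H, -⟩ := P.reflects b
  have hb : P.rho b z (P.act z b) := ⟨hV, rfl⟩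
  rcases h with h | ⟨q, h⟩
  · rw [h] at hb
    exact H _ _ hb.2.symm
  · rw [h] at hb
    obtain ⟨w, -, hw⟩ := hb
    exact H _ _ hw.2.symm

theorem PartialRep.eq_of_rho_eq [Semigroup S] {l r : S → S → Prop} {X : Type u}
    (P : PartialRep l r X) {b c : S} (hbc : r b c) (hcb : r c b) (h : P.rho b = P.rho c) :
    b = c := by
  obtain ⟨z, hV, -, H⟩ := P.reflects b
  have hb : P.rho b z (P.act z b) := ⟨hV, rfl⟩
  rw [h] at hb
  exact H _ hbc hcb hb.2

namespace EmbPair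

variable [Semigroup S] {l r : S → S → Prop}

/-- Pairs `(u, x)` with `u ∈ G(S)` and `x ≤_r u`, representing the fraction `u♯ x`. -/
def PreFrac (l r : S → S → Prop) : Type u := { p : S × S // p.1 ∈ GS l r ∧ r p.2 p.1 }

/-- Equality of fractions. -/
def fracSetoid (h : EmbPair l r) (hrev : RightReversible l r) : Setoid (PreFrac l r) where
  r z w := Hp l r w.1.1 z.1.1 ∧ ∃ p q, Hp l r p z.1.1 ∧ Hp l r q z.1.1 ∧
    p * z.1.1 = q * w.1.1 ∧ p * z.1.2 = q * w.1.2
  iseqv := by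
    refine ⟨fun z => ⟨h.Hrefl _, _, _, h.Hrefl _, h.Hrefl _, rfl, rfl⟩, ?_, ?_⟩
    · rintro z w ⟨hH, p, q, hp, hq, e1, e2⟩
      have hH' := h.Hsymm hH
      exact ⟨hH', q, p, h.Htrans hq hH', h.Htrans hp hH', e1.symm, e2.symm⟩
    · rintro z w v ⟨hH, p, q, hp, hq, e1, e2⟩ ⟨hH', p', q', hp', hq', e1', e2'⟩
      have hz := z.2.1
      obtain ⟨s, t, hs, ht, e⟩ := hrev _ hz q p' hq (h.Htrans hp' hH)
      refine ⟨h.Htrans hH' hH, s * p, t * q', h.H_mul hz hs hp,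
        h.H_mul hz ht (h.Htrans hq' hH), ?_, ?_⟩
      · rw [mul_assoc, e1, ← mul_assoc, e, mul_assoc, e1', mul_assoc]
      · rw [mul_assoc, e2, ← mul_assoc, e, mul_assoc, e2', mul_assoc]

/-- The right `S`-act of fractions `u♯ x`. -/
def fracRep (h : EmbPair l r) (hrev : RightReversible l r) :
    PartialRep l r (Quotient (h.fracSetoid hrev)) where
  act z s := Quotient.map (sa := h.fracSetoid hrev) (sb := h.fracSetoid hrev)
    (fun p => ⟨(p.1.1, p.1.2 * s), p.2.1, h.rtrans (h.rmem _ s) p.2.2⟩)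
    (by
      rintro z w ⟨hH, p, q, hp, hq, e1, e2⟩
      exact ⟨hH, p, q, hp, hq, e1, by simp only [← mul_assoc, e2]⟩) z
  V z := Quotient.lift (s := h.fracSetoid hrev) (fun p => r p.1.1 p.1.2)
    (by
      have key : ∀ z w : PreFrac l r, (h.fracSetoid hrev).r z w →
          r z.1.1 z.1.2 → r w.1.1 w.1.2 := by
        rintro z w ⟨hH, p, q, hp, hq, e1, e2⟩ hz
        have hqG := h.mem_GS_of_H z.2.1 hq
        have h1 : r w.1.1 q := (h.Htrans hH (h.Hsymm hq)).2.1
        have h2 : Rp r (p * z.1.2) (p * z.1.1) := h.Rmul p ⟨z.2.2, hz⟩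
        rw [e1, e2] at h2
        exact (h.eviir hqG (h.rtrans w.2.2 h1) h1 h2).2
      exact fun z w hzw => propext ⟨key z w hzw, key w z ((h.fracSetoid hrev).symm hzw)⟩) z
  U c z := Quotient.lift (s := h.fracSetoid hrev) (fun p => l p.1.2 c)
    (by
      have key : ∀ z w : PreFrac l r, (h.fracSetoid hrev).r z w → l z.1.2 c → l w.1.2 c := by
        rintro z w ⟨hH, p, q, hp, hq, e1, e2⟩ hz
        have hqG := h.mem_GS_of_H z.2.1 hq
        have h1 : r w.1.1 q := (h.Htrans hH (h.Hsymm hq)).2.1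
        have h2 := h.evr hqG (h.rtrans w.2.2 h1)
        rw [← e2] at h2
        exact h.ltrans h2.2 (h.ltrans (h.lmem _ _) hz)
      exact fun z w hzw => propext ⟨key z w hzw, key w z ((h.fracSetoid hrev).symm hzw)⟩) z
  act_act := by
    rintro ⟨z⟩ s t
    exact congrArg (Quotient.mk (h.fracSetoid hrev))
      (Subtype.ext (congrArg (Prod.mk z.1.1) (mul_assoc z.1.2 s t)))
  V_of_act := by
    rintro ⟨z⟩ s hz
    exact h.rtrans hz (h.rmem _ s)
  U_act := by
    rintro b c ⟨z⟩ hb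
    exact h.ltrans (h.lmem _ _) hb
  inj := by
    rintro c ⟨z⟩ ⟨w⟩ hc hz hw e
    obtain ⟨hH, p, q, hp, hq, e1, e2⟩ := Quotient.exact e
    refine Quotient.sound ⟨hH, p, q, hp, hq, e1, ?_⟩
    refine h.evil hc (h.ltrans (h.lmem _ _) hz) (h.ltrans (h.lmem _ _) hw) ?_
    simpa only [mul_assoc] using e2
  act_eq := by
    rintro b c ⟨z⟩ ⟨w⟩ hb e
    obtain ⟨hH, p, q, hp, hq, e1, e2⟩ := Quotient.exact e
    refine Quotient.sound ⟨hH, p, q, hp, hq, e1, ?_⟩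
    simp only [← mul_assoc] at e2 ⊢
    exact h.rcancel hb e2
  V_mono := by
    rintro b c ⟨z⟩ hb hz
    exact h.rtrans hz (h.rmul _ hb)
  V_act := by
    rintro c ⟨z⟩ hc hV hU
    exact h.rtrans hV (h.evl hc hU).2
  surj := by
    rintro c ⟨z⟩ hc hV hU
    obtain ⟨u, v, hu, hv, hvc, e⟩ := h.left_ore hrev z.2.1 ⟨z.2.2, hV⟩ hc hU
    have hH := h.H_mul z.2.1 hu (h.Hrefl _)
    refine ⟨Quotient.mk _ ⟨(u * z.1.1, v), h.mem_GS_of_H z.2.1 hH, h.rtrans hv.1 hH.2.2⟩,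
      hvc, Quotient.sound ⟨h.Hsymm hH, z.1.1, z.1.1 * u, h.Hsymm hH,
        h.Htrans (h.H_mul z.2.1 (h.Hrefl _) hu) (h.Hsymm hH), ?_, ?_⟩⟩
    · exact (mul_assoc _ _ _).symm
    · exact (congrArg _ e.symm).trans (mul_assoc _ _ _).symm
  reflects := by
    intro b
    obtain ⟨g, hg, hbg⟩ := h.gr b
    refine ⟨Quotient.mk _ ⟨(g, g), hg, h.rrefl g⟩, h.rtrans hg.2.1 (h.rmul g hbg.2), ?_, ?_⟩
    · rintro c ⟨w⟩ e
      obtain ⟨hH, p, q, hp, hq, e1, e2⟩ := Quotient.exact e.symm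
      change p * (g * b) = q * (w.1.2 * c) at e2
      have hpg := h.H_mul hg hp (h.Hrefl g)
      have := h.evr (h.mem_GS_of_H hg hpg) (h.rtrans hbg.1 hpg.2.2)
      rw [mul_assoc, e2, ← mul_assoc] at this
      exact h.ltrans this.2 (h.lmem _ _)
    · intro c hbc hcb e
      obtain ⟨hH, p, q, hp, hq, e1, e2⟩ := Quotient.exact e
      obtain rfl : p = q := h.evil hg hp.1.1 hq.1.1 e1
      have hpg := h.H_mul hg hp (h.Hrefl g)
      refine h.evir (h.mem_GS_of_H hg hpg) (h.rtrans hbg.1 hpg.2.2)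
        (h.rtrans hcb (h.rtrans hbg.1 hpg.2.2)) ?_
      simpa only [mul_assoc] using e2

end EmbPair

theorem IsGroupInverse.op [Semigroup Q] {q h : Q} (H : IsGroupInverse q h) :
    IsGroupInverse (MulOpposite.op q) (MulOpposite.op h) := by
  obtain ⟨h1, h2, h3⟩ := H
  refine ⟨congrArg MulOpposite.op h1.symm, congrArg MulOpposite.op ?_,
    congrArg MulOpposite.op ?_⟩
  · exact (mul_assoc _ _ _).symm.trans h2
  · exact (mul_assoc _ _ _).symm.trans h3

theorem IsGroupInverse.unop [Semigroup Q] {q h : Qᵐᵒᵖ} (H : IsGroupInverse q h) :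
    IsGroupInverse q.unop h.unop := by
  obtain ⟨h1, h2, h3⟩ := H
  refine ⟨congrArg MulOpposite.unop h1.symm, ?_, ?_⟩
  · exact (mul_assoc _ _ _).trans (congrArg MulOpposite.unop h2)
  · exact (mul_assoc _ _ _).trans (congrArg MulOpposite.unop h3)

theorem leR_op [Semigroup Q] {p q : Q} :
    leR (MulOpposite.op p) (MulOpposite.op q) ↔ leL p q := by
  constructor
  · rintro (h | ⟨x, h⟩)
    · exact .inl (MulOpposite.op_injective h)
    · exact .inr ⟨x.unop, congrArg MulOpposite.unop h⟩
  · rintro (h | ⟨x, h⟩)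
    · exact .inl (congrArg _ h)
    · exact .inr ⟨.op x, congrArg MulOpposite.op h⟩

theorem leL_op [Semigroup Q] {p q : Q} :
    leL (MulOpposite.op p) (MulOpposite.op q) ↔ leR p q := by
  constructor
  · rintro (h | ⟨x, h⟩)
    · exact .inl (MulOpposite.op_injective h)
    · exact .inr ⟨x.unop, congrArg MulOpposite.unop h⟩
  · rintro (h | ⟨x, h⟩)
    · exact .inl (congrArg _ h)
    · exact .inr ⟨.op x, congrArg MulOpposite.op h⟩

namespace GroupRep

variable [Semigroup S] {l r : S → S → Prop} {T : Type u} [Semigroup T]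

theorem op {φ i : S → T} (G : GroupRep l r φ i) :
    GroupRep (opRel r) (opRel l) (fun s : Sᵐᵒᵖ => MulOpposite.op (φ s.unop))
      (fun s => MulOpposite.op (i s.unop)) where
  map_mul s t := congrArg MulOpposite.op (G.map_mul t.unop s.unop)
  inv hc := (G.inv (mem_GS_unop hc)).op
  mul_idem hc hb := congrArg MulOpposite.op
    ((congrArg (· * _) (G.inv (mem_GS_unop hc)).1.symm).trans (G.idem_mul (mem_GS_unop hc) hb))
  idem_mul hc hb := congrArg MulOpposite.op
    ((congrArg (_ * ·) (G.inv (mem_GS_unop hc)).1.symm).trans (G.mul_idem (mem_GS_unop hc) hb))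

theorem of_op {φ i : Sᵐᵒᵖ → T} (G : GroupRep (opRel r) (opRel l) φ i) :
    GroupRep l r (fun s : S => MulOpposite.op (φ (.op s)))
      (fun s => MulOpposite.op (i (.op s))) where
  map_mul s t := congrArg MulOpposite.op (G.map_mul (.op t) (.op s))
  inv hc := (G.inv (mem_GS_op hc)).op
  mul_idem hc hb := congrArg MulOpposite.op
    ((congrArg (· * _) (G.inv (mem_GS_op hc)).1.symm).trans (G.idem_mul (mem_GS_op hc) hb))
  idem_mul hc hb := congrArg MulOpposite.op
    ((congrArg (_ * ·) (G.inv (mem_GS_op hc)).1.symm).trans (G.mul_idem (mem_GS_op hc) hb))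

theorem prod {T' : Type u} [Semigroup T'] {φ i : S → T} {φ' i' : S → T'}
    (G : GroupRep l r φ i) (G' : GroupRep l r φ' i') :
    GroupRep l r (fun s => (φ s, φ' s)) (fun s => (i s, i' s)) where
  map_mul s t := Prod.ext (G.map_mul s t) (G'.map_mul s t)
  inv hc := ⟨Prod.ext (G.inv hc).1 (G'.inv hc).1, Prod.ext (G.inv hc).2.1 (G'.inv hc).2.1,
    Prod.ext (G.inv hc).2.2 (G'.inv hc).2.2⟩
  mul_idem hc hb := Prod.ext (G.mul_idem hc hb) (G'.mul_idem hc hb)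
  idem_mul hc hb := Prod.ext (G.idem_mul hc hb) (G'.idem_mul hc hb)

end GroupRep

theorem leL.map [Semigroup Q] {T : Type u} [Semigroup T] {f : Q → T}
    (hf : ∀ a b, f (a * b) = f a * f b) {p q : Q} (h : leL p q) : leL (f p) (f q) := by
  rcases h with rfl | ⟨x, rfl⟩
  · exact .inl rfl
  · exact .inr ⟨_, hf _ _⟩

theorem leR.map [Semigroup Q] {T : Type u} [Semigroup T] {f : Q → T}
    (hf : ∀ a b, f (a * b) = f a * f b) {p q : Q} (h : leR p q) : leR (f p) (f q) := by
  rcases h with rfl | ⟨x, rfl⟩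
  · exact .inl rfl
  · exact .inr ⟨_, hf _ _⟩

/-- A faithful representation of `S` which reflects the two preorders. -/
theorem EmbPair.exists_groupRep [Semigroup S] {l r : S → S → Prop} (h : EmbPair l r)
    (hr : RightReversible l r) (hl : LeftReversible l r) :
    ∃ (T : Type u) (_ : Semigroup T) (φ i : S → T), GroupRep l r φ i ∧
      Function.Injective φ ∧ (∀ b c, leL (φ b) (φ c) → l b c) ∧
      (∀ b c, leR (φ b) (φ c) → r b c) := by
  let P := h.fracRep hr
  let P' := h.op.fracRep hl.op
  have H1 : ∀ b c, leL (P.rho b, MulOpposite.op (P'.rho (.op b)))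
      (P.rho c, MulOpposite.op (P'.rho (.op c))) → l b c := fun b c hbc =>
    P.le_of_leL (hbc.map (f := Prod.fst) fun _ _ => rfl)
  have H2 : ∀ b c, leR (P.rho b, MulOpposite.op (P'.rho (.op b)))
      (P.rho c, MulOpposite.op (P'.rho (.op c))) → r b c := fun b c hbc =>
    P'.le_of_leL (b := .op b) (c := .op c)
      (leR_op.1 (hbc.map (f := Prod.snd) fun _ _ => rfl))
  refine ⟨_, _, _, _, (P.groupRep h.lrefl h.rrefl).prod
    (P'.groupRep h.op.lrefl h.op.rrefl).of_op, fun b c hbc => ?_, H1, H2⟩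
  exact P.eq_of_rho_eq (H2 _ _ (.inl hbc)) (H2 _ _ (.inl hbc.symm)) (congrArg Prod.fst hbc)

namespace GroupRep

variable [Semigroup S] {l r : S → S → Prop} {T : Type u} [Semigroup T] {φ i : S → T}

theorem idem_mul' (G : GroupRep l r φ i) {b c : S} (hc : c ∈ GS l r) (hb : r b c) :
    i c * (φ c * φ b) = φ b := by
  rw [← mul_assoc, ← (G.inv hc).1, G.idem_mul hc hb]

theorem inv_mul_idem (G : GroupRep l r φ i) {b c : S} (hb : b ∈ GS l r) (hc : c ∈ GS l r)
    (hbc : l b c) : i b * (φ c * i c) = i b := by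
  calc i b * (φ c * i c) = i b * φ b * i b * (φ c * i c) := by rw [(G.inv hb).2.2]
    _ = i b * i b * (φ b * (φ c * i c)) := by
      rw [mul_assoc (i b), (G.inv hb).1]
      simp only [mul_assoc]
    _ = i b := by
      rw [G.mul_idem hc hbc, mul_assoc, ← (G.inv hb).1, ← mul_assoc, (G.inv hb).2.2]

/-- Group inverses reverse products within an `H'`-class. -/
theorem inv_mul (G : GroupRep l r φ i) (h : EmbPair l r) {a b : S} (ha : a ∈ GS l r)
    (hb : Hp l r b a) : i (a * b) = i b * i a := by
  have hbG := h.mem_GS_of_H ha hb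
  have hab := h.H_mul ha (h.Hrefl a) hb
  have habG := h.mem_GS_of_H ha hab
  have e1 : φ b * i b * i a = i a := by
    rw [← (G.inv ha).2.2, (G.inv ha).1.symm, mul_assoc (φ a), ← mul_assoc,
      G.idem_mul hbG hb.2.2]
  calc i (a * b) = i (a * b) * (φ a * i a) :=
        (G.inv_mul_idem habG ha hab.1.1).symm
    _ = i (a * b) * (φ a * (φ b * i b * i a)) := by rw [e1]
    _ = i (a * b) * φ (a * b) * (i b * i a) := by rw [G.map_mul]; simp only [mul_assoc]
    _ = φ (a * b) * i (a * b) * (φ b * i b * i b) * i a := by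
      rw [(G.inv hbG).1, (G.inv hbG).2.2, (G.inv habG).1]; simp only [mul_assoc]
    _ = i b * i a := by
      rw [mul_assoc (φ b), ← mul_assoc (φ (a * b) * i (a * b)),
        G.idem_mul habG (h.Htrans hb (h.Hsymm hab)).2.1, ← mul_assoc, (G.inv hbG).1,
        (G.inv hbG).2.2]

theorem mul_inv_eq (G : GroupRep l r φ i) (h : EmbPair l r) (hrev : RightReversible l r)
    {g c x : S} (hg : g ∈ GS l r) (hx : Rp r x g) (hc : c ∈ GS l r) (hxc : l x c) :
    ∃ u v, Hp l r u g ∧ Rp r v g ∧ l v c ∧ u * x = v * c ∧ φ x * i c = i u * φ v := by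
  obtain ⟨u, v, hu, hv, hvc, e⟩ := h.left_ore hrev hg hx hc hxc
  refine ⟨u, v, hu, hv, hvc, e, ?_⟩
  have huG := h.mem_GS_of_H hg hu
  rw [← G.idem_mul' huG (h.Rtrans hx hu.2.symm).1, ← G.map_mul, e, G.map_mul, mul_assoc,
    mul_assoc, G.mul_idem hc hvc]

theorem inv_mul_eq (G : GroupRep l r φ i) (h : EmbPair l r) (hrev : LeftReversible l r)
    {g c x : S} (hg : g ∈ GS l r) (hx : Lp l x g) (hc : c ∈ GS l r) (hxc : r x c) :
    ∃ u v, Hp l r u g ∧ Lp l v g ∧ r v c ∧ x * u = c * v ∧ i c * φ x = φ v * i u := by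
  obtain ⟨u, v, hu, hv, hvc, e, e'⟩ := G.op.mul_inv_eq h.op hrev.op (mem_GS_op hg)
    (x := .op x) hx (mem_GS_op hc) hxc
  exact ⟨u.unop, v.unop, hp_unop hu, hv, hvc, congrArg MulOpposite.unop e,
    congrArg MulOpposite.unop e'⟩

/-- The fractions `a♯ b` with `a R' b`. -/
def fractions (l r : S → S → Prop) (φ i : S → T) : Set T :=
  { t | ∃ a b, a ∈ GS l r ∧ Rp r a b ∧ t = i a * φ b }

theorem mul_inv_mem (G : GroupRep l r φ i) (h : EmbPair l r) (hrev : RightReversible l r)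
    {c x y : S} (hc : c ∈ GS l r) (hxc : Lp l x c) (hy : Rp r y c) :
    φ x * i c * φ y ∈ fractions l r φ i := by
  obtain ⟨g, hg, hx⟩ := h.gr x
  obtain ⟨u, v, hu, hv, hvc, e, e'⟩ := G.mul_inv_eq h hrev hg hx hc hxc.1
  refine ⟨u, v * y, h.mem_GS_of_H hg hu, ?_, by rw [e', G.map_mul, mul_assoc]⟩
  have := h.Rtrans (h.Rmul v hy) (h.Rtrans (h.evl hc hvc) hv)
  exact h.Rtrans hu.2 this.symm

theorem mul_mem_fractions (G : GroupRep l r φ i) (h : EmbPair l r) (hr : RightReversible l r)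
    (hl : LeftReversible l r) {t t' : T} (ht : t ∈ fractions l r φ i)
    (ht' : t' ∈ fractions l r φ i) : t * t' ∈ fractions l r φ i := by
  obtain ⟨a, b, ha, hab, rfl⟩ := ht
  obtain ⟨c₀, d₀, hc₀, hcd₀, rfl⟩ := ht'
  obtain ⟨c, hc, hdc⟩ := h.gl d₀
  obtain ⟨c', d, hc', hd, -, -, e⟩ := G.inv_mul_eq h hl hc hdc hc₀ hcd₀.2
  have hc'G := h.mem_GS_of_H hc hc'
  have hdc' : Lp l d c' := h.Ltrans hd hc'.1.symm
  obtain ⟨g, hg, hbg⟩ := h.gl (b * d)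
  obtain ⟨v, u, hv, hu, -, -, e1⟩ :=
    G.inv_mul_eq h hl hg hbg ha (h.rtrans (h.rmem b d) hab.2)
  have hvG := h.mem_GS_of_H hg hv
  have hvc : l v c' := h.ltrans (h.ltrans hv.1.1 hbg.2) (h.ltrans (h.lmem b d) hdc'.1)
  obtain ⟨w, k, hw, hk, -, -, e2⟩ := G.mul_inv_eq h hr hvG (h.Rrefl v) hc'G hvc
  have e3 : i v * i c' = i (w * v * v) * φ k := by
    have hwG := h.mem_GS_of_H hvG hw
    rw [G.inv_mul h (h.mem_GS_of_H hvG (h.H_mul hvG hw (h.Hrefl v)))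
      (h.Hsymm (h.H_mul hvG hw (h.Hrefl v))), G.inv_mul h hwG (h.Hsymm hw), mul_assoc,
      mul_assoc, ← e2, ← mul_assoc (i v) (φ v), ← mul_assoc (i v),
      ← (G.inv hvG).1, ← mul_assoc (i v), (G.inv hvG).2.2]
  have hm := h.H_mul hvG (h.H_mul hvG hw (h.Hrefl v)) (h.Hrefl v)
  have key := G.mul_inv_mem h hr (h.mem_GS_of_H hvG hm)
    (h.Ltrans hu (h.Ltrans hv.1.symm hm.1.symm)) (h.Rtrans hk hm.2.symm)
  rwa [mul_assoc, ← e3, ← mul_assoc, ← e1, G.map_mul, mul_assoc, mul_assoc, ← e,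
    ← mul_assoc] at key

end GroupRep

namespace GroupRep

variable [Semigroup S] {l r : S → S → Prop} {T : Type u} [Semigroup T] {φ i : S → T}

theorem map_mem_fractions (G : GroupRep l r φ i) (h : EmbPair l r) (s : S) :
    φ s ∈ fractions l r φ i := by
  obtain ⟨g, hg, hsg⟩ := h.gr s
  refine ⟨g, g * s, hg, h.Rtrans hg.2 (h.Rmul g hsg.symm), ?_⟩
  rw [G.map_mul, G.idem_mul' hg hsg.1]

theorem inv_mem_fractions (G : GroupRep l r φ i) (h : EmbPair l r) {a : S}
    (ha : a ∈ GS l r) : i a ∈ fractions l r φ i := by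
  refine ⟨a * a, a, h.mem_GS_of_H ha (h.Hsymm ha), ha.2.symm, ?_⟩
  rw [G.inv_mul h ha (h.Hrefl a), mul_assoc, ← (G.inv ha).1, ← mul_assoc, (G.inv ha).2.2]

theorem exists_eq_mul_of_ler (G : GroupRep l r φ i) (h : EmbPair l r)
    (hr : RightReversible l r) (hl : LeftReversible l r) {b c : S} (hbc : r b c) :
    ∃ x ∈ fractions l r φ i, φ b = φ c * x := by
  obtain ⟨g, hg, hcg⟩ := h.gr c
  obtain ⟨y, -, -, -, -, H⟩ := h.exists_mul_H hcg
  have hH := H c (h.Hrefl c)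
  have hG := h.mem_GS_of_H hg hH
  refine ⟨φ y * i (c * y) * φ b, G.mul_mem_fractions h hr hl (G.mul_mem_fractions h hr hl
    (G.map_mem_fractions h y) (G.inv_mem_fractions h hG)) (G.map_mem_fractions h b), ?_⟩
  rw [← mul_assoc, ← mul_assoc, ← G.map_mul,
    G.idem_mul hG (h.rtrans (h.rtrans hbc hcg.1) hH.2.2)]

theorem exists_eq_mul_inv (G : GroupRep l r φ i) (h : EmbPair l r)
    (hl : LeftReversible l r) {t : T} (ht : t ∈ fractions l r φ i) :
    ∃ a b, a ∈ GS l r ∧ Lp l a b ∧ t = φ b * i a := by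
  obtain ⟨a, b, ha, hab, rfl⟩ := ht
  obtain ⟨g, hg, hbg⟩ := h.gl b
  obtain ⟨u, v, hu, hv, -, -, e⟩ := G.inv_mul_eq h hl hg hbg ha hab.2
  exact ⟨u, v, h.mem_GS_of_H hg hu, h.Ltrans hu.1 hv.symm, e⟩

theorem mem_fractions_op (G : GroupRep l r φ i) (h : EmbPair l r)
    (hr : RightReversible l r) {t : T} (ht : MulOpposite.op t ∈ fractions (opRel r) (opRel l)
      (fun s : Sᵐᵒᵖ => MulOpposite.op (φ s.unop)) (fun s => MulOpposite.op (i s.unop))) :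
    t ∈ fractions l r φ i := by
  obtain ⟨a, b, ha, hab, e⟩ := ht
  obtain rfl : t = φ b.unop * i a.unop := congrArg MulOpposite.unop e
  obtain ⟨g, hg, hbg⟩ := h.gr b.unop
  obtain ⟨u, v, hu, hv, -, -, e'⟩ := G.mul_inv_eq h hr hg hbg (mem_GS_unop ha) hab.2
  exact ⟨u, v, h.mem_GS_of_H hg hu, h.Rtrans hu.2 hv.symm, e'⟩

theorem exists_eq_mul_of_lel (G : GroupRep l r φ i) (h : EmbPair l r)
    (hr : RightReversible l r) (hl : LeftReversible l r) {b c : S} (hbc : l b c) :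
    ∃ x ∈ fractions l r φ i, φ b = x * φ c := by
  have hr' : LeftReversible (opRel r) (opRel l) := by
    intro a ha x y hx hy
    obtain ⟨u, v, hu, hv, e⟩ := hr _ (mem_GS_unop ha) _ _ (hp_unop hx) (hp_unop hy)
    exact ⟨.op u, .op v, hp_op hu, hp_op hv, congrArg MulOpposite.op e⟩
  obtain ⟨x, hx, e⟩ := G.op.exists_eq_mul_of_ler h.op hl.op hr' (b := .op b) (c := .op c) hbc
  exact ⟨x.unop, G.mem_fractions_op h hr hx, congrArg MulOpposite.unop e⟩

end GroupRep

/-- Embeddable `*`-pairs with both reversibility conditions arise from straight orders. -/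
theorem EmbPair.exists_straightOrderExtension [Semigroup S] {l r : S → S → Prop}
    (h : EmbPair l r) (hr : RightReversible l r) (hl : LeftReversible l r)
    (hS : ∀ a : S, SqC a → a ∈ GS l r) :
    ∃ (Q : Type u) (iQ : Semigroup Q) (f : S → Q), @StraightOrderExtension S _ l r Q iQ f := by
  obtain ⟨T, _, φ, i, G, hinj, hL, hR⟩ := h.exists_groupRep hr hl
  let M : Subsemigroup T :=
    ⟨GroupRep.fractions l r φ i, fun ha hb => G.mul_mem_fractions h hr hl ha hb⟩
  let f : S → M := fun s => ⟨φ s, G.map_mem_fractions h s⟩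
  have hinv : ∀ a (ha : a ∈ GS l r),
      IsGroupInverse (f a) (⟨i a, G.inv_mem_fractions h ha⟩ : M) := fun a ha =>
    ⟨Subtype.ext (G.inv ha).1, Subtype.ext (G.inv ha).2.1, Subtype.ext (G.inv ha).2.2⟩
  have hfL : ∀ b c, l b c ↔ leL (f b) (f c) := by
    refine fun b c => ⟨fun hbc => ?_, fun hbc => hL b c (hbc.map (f := Subtype.val) fun _ _ => rfl)⟩
    obtain ⟨x, hx, e⟩ := G.exists_eq_mul_of_lel h hr hl hbc
    exact .inr ⟨⟨x, hx⟩, Subtype.ext e⟩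
  have hfR : ∀ b c, r b c ↔ leR (f b) (f c) := by
    refine fun b c => ⟨fun hbc => ?_, fun hbc => hR b c (hbc.map (f := Subtype.val) fun _ _ => rfl)⟩
    obtain ⟨x, hx, e⟩ := G.exists_eq_mul_of_ler h hr hl hbc
    exact .inr ⟨⟨x, hx⟩, Subtype.ext e⟩
  refine ⟨M, inferInstance, f, ⟨fun a b hab => hinj (congrArg Subtype.val hab),
    fun a b => Subtype.ext (G.map_mul a b), ?_, fun a ha => ⟨_, hinv a (hS a ha)⟩,
    fun b c => ⟨hfL b c, hfR b c⟩⟩, ?_⟩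
  · rintro ⟨q, hq⟩
    obtain ⟨a, b, ha, hab, rfl⟩ := id hq
    exact ⟨a, b, ⟨_, hinv a ha, rfl⟩, (hfR _ _).1 hab.1, (hfR _ _).1 hab.2⟩
  · rintro ⟨q, hq⟩
    obtain ⟨a, b, ha, hab, rfl⟩ := G.exists_eq_mul_inv h hl hq
    exact ⟨a, b, ⟨_, hinv a ha, rfl⟩, (hfL _ _).1 hab.1, (hfL _ _).1 hab.2⟩

theorem IsGroupInverse.mul_mul_of_leL [Semigroup Q] {q k t : Q} (H : IsGroupInverse q k)
    (ht : leL t q) : t * (k * q) = t := by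
  rcases ht with rfl | ⟨x, rfl⟩
  · rw [← mul_assoc, H.2.1]
  · rw [mul_assoc, ← mul_assoc q, H.2.1]

theorem IsGroupInverse.mul_mul_of_leR [Semigroup Q] {q k t : Q} (H : IsGroupInverse q k)
    (ht : leR t q) : q * (k * t) = t := by
  rcases ht with rfl | ⟨x, rfl⟩
  · rw [← mul_assoc, H.2.1]
  · rw [← mul_assoc, ← mul_assoc, H.2.1]

theorem mem_GS_of_inSubgroup [Semigroup S] {l r : S → S → Prop} (h : EmbPair l r) [Semigroup Q]
    {f : S → Q} (hmul : ∀ a b, f (a * b) = f a * f b) (hL : ∀ b c, l b c ↔ leL (f b) (f c))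
    (hR : ∀ b c, r b c ↔ leR (f b) (f c)) {a : S} (ha : inSubgroup (f a)) : a ∈ GS l r := by
  obtain ⟨k, hk⟩ := ha
  refine ⟨⟨(hL _ _).2 (.inr ⟨k, ?_⟩), h.lmem a a⟩, (hR _ _).2 (.inr ⟨k, ?_⟩), h.rmem a a⟩
  · rw [hmul, ← mul_assoc, ← hk.1, hk.2.1]
  · rw [hmul, mul_assoc, hk.1, ← mul_assoc, hk.2.1]

/-- In a straight left order inducing an embeddable `*`-pair, the `H'`-classes of elements
of subgroups are right reversible. -/
theorem EmbPair.rightReversible_of_order [Semigroup S] {l r : S → S → Prop}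
    (h : EmbPair l r) [Semigroup Q] {f : S → Q} (hinj : Function.Injective f)
    (hmul : ∀ a b, f (a * b) = f a * f b)
    (hst : ∀ q, ∃ a b, (∃ c, IsGroupInverse (f a) c ∧ q = c * f b) ∧ GreenR (f a) (f b))
    (hG : ∀ a ∈ GS l r, inSubgroup (f a)) (hL : ∀ b c, l b c ↔ leL (f b) (f c))
    (hR : ∀ b c, r b c ↔ leR (f b) (f c)) : RightReversible l r := by
  intro a ha x y hx hy
  have hyG := h.mem_GS_of_H ha hy
  obtain ⟨y', hy'⟩ := hG y hyG
  obtain ⟨k, d, ⟨k', hk, hq⟩, hkd⟩ := hst (f a * f x * y')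
  have hkd' : Rp r k d := ⟨(hR _ _).2 hkd.1, (hR _ _).2 hkd.2⟩
  have hkG : k ∈ GS l r := mem_GS_of_inSubgroup h hmul hL hR ⟨k', hk⟩
  have hax : Hp l r (a * x) a := h.H_mul ha (h.Hrefl a) hx
  have hqy : f a * f x * y' * f y = f (a * x) := by
    rw [hmul, mul_assoc, mul_assoc, hy'.mul_mul_of_leL ((hL x y).1 (h.ltrans hx.1.1 hy.1.2))]
  have hak : r a k := by
    refine h.rtrans hax.2.2 ((hR _ _).2 (.inr ⟨k' * (k' * f d * f y), ?_⟩))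
    rw [← hqy, hq, ← mul_assoc (f k), hk.1]
    simp only [← mul_assoc]
    rw [hk.2.2]
  have hka : r k a := by
    have hqk : f k = k' * f d * f k ∨ ∃ z, f k = k' * f d * z := by
      rcases hkd.1 with e | ⟨z, e⟩
      · left
        rw [← e, ← hk.1, hk.2.1]
      · right
        refine ⟨z * f k, ?_⟩
        rw [← mul_assoc, mul_assoc k', ← e, ← hk.1, hk.2.1]
    obtain ⟨z, e⟩ : ∃ z, f k = k' * f d * z := hqk.elim (fun e => ⟨_, e⟩) id
    refine (hR _ _).2 (.inr ⟨f x * y' * z, ?_⟩)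
    rw [e, ← hq]
    simp only [mul_assoc]
  have hkaH : Hp l r (k * a) a :=
    ⟨h.evr hkG hak, h.Rtrans (h.Rmul k ⟨hak, hka⟩) (h.Rtrans hkG.2.symm ⟨hka, hak⟩)⟩
  have hd : f d = f k * (f a * f x * y') := by
    rw [hq, hk.mul_mul_of_leR hkd.2]
  have hdy : k * a * x = d * y := by
    apply hinj
    rw [hmul d, hd, mul_assoc (f k), hqy, mul_assoc, hmul]
  have hldy : l d y := by
    refine (hL _ _).2 (.inr ⟨f k * (f a * f x * (y' * y')), ?_⟩)
    rw [mul_assoc (f k), mul_assoc (f a * f x), mul_assoc y', ← hy'.1, ← mul_assoc y', hy'.2.2, hd]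
  have hH : Hp l r (d * y) a := hdy ▸ h.H_mul ha hkaH hx
  refine ⟨k * a, d, hkaH, ⟨?_, h.Rtrans hkd'.symm ⟨hka, hak⟩⟩, hdy⟩
  exact h.Ltrans (h.eviil hyG hldy (h.lrefl y)
    (h.Ltrans hH.1 (h.Ltrans hy.1.symm hyG.1))) hy.1

theorem IsStarPair.sqC_of_mem_GS [Semigroup S] {l r : S → S → Prop} (h : IsStarPair l r) {a : S}
    (ha : a ∈ GS l r) : SqC a :=
  have hl := h.2.2.2.2.2.2.1
  have hr := h.2.2.2.2.2.2.2
  ⟨hl _ _ ha.1.1, hl _ _ ha.1.2, hr _ _ ha.2.1, hr _ _ ha.2.2⟩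

/-- Corollary 4.10: let `S` be a semigroup having an embeddable `*`-pair `(lel, ler)`.
Then there is a semigroup `Q` containing `S` as a subsemigroup such that `S` is a
straight (two-sided) order in `Q` and `Q` induces `(lel, ler)`, if and only if
`(lel, ler)` satisfies (Gi), (Gii) and the dual condition (Gii)'. -/
theorem straight_order_iff_Gi_Gii_Gii' {S : Type u} [Semigroup S]
    (lel ler : S → S → Prop) (hemb : IsEmbeddableStarPair lel ler) :
    (∃ (Q : Type u) (iQ : Semigroup Q) (f : S → Q),
      @StraightOrderExtension S _ lel ler Q iQ f) ↔
    (CondGi lel ler ∧ CondGii lel ler ∧ CondGii' lel ler) := by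
  have h := hemb.embPair
  constructor
  · rintro ⟨Q, _, f, ⟨hinj, hmul, hst, hsub, hLR⟩, hst'⟩
    have hL := fun b c => (hLR b c).1
    have hR := fun b c => (hLR b c).2
    have hGi : SqSet S = GS lel ler := Set.Subset.antisymm
      (fun a ha => mem_GS_of_inSubgroup h hmul hL hR (hsub a ha))
      (fun a ha => hemb.1.sqC_of_mem_GS ha)
    have hG : ∀ a ∈ GS lel ler, inSubgroup (f a) := fun a ha => hsub a (hGi.ge ha)
    refine ⟨hGi, ?_, ?_⟩
    · unfold CondGii
      rw [hGi]
      exact h.rightReversible_of_order hinj hmul hst hG hL hR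
    · unfold CondGii'
      rw [hGi]
      refine RightReversible.of_op (h.op.rightReversible_of_order
        (f := fun s => MulOpposite.op (f s.unop)) ?_ ?_ ?_ ?_ ?_ ?_)
      · exact fun a b hab => MulOpposite.unop_injective (hinj (MulOpposite.op_injective hab))
      · exact fun a b => congrArg MulOpposite.op (hmul b.unop a.unop)
      · intro q
        obtain ⟨a, b, ⟨c, hc, e⟩, h1, h2⟩ := hst' q.unop
        exact ⟨.op a, .op b, ⟨.op c, hc.op, congrArg MulOpposite.op e⟩,
          leR_op.2 h1, leR_op.2 h2⟩
      · intro a ha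
        obtain ⟨c, hc⟩ := hG _ (mem_GS_unop ha)
        exact ⟨.op c, hc.op⟩
      · exact fun b c => (hR _ _).trans leL_op.symm
      · exact fun b c => (hL _ _).trans leR_op.symm
  · rintro ⟨hGi, hr, hl⟩
    unfold CondGi at hGi
    unfold CondGii at hr
    unfold CondGii' at hl
    rw [hGi] at hr hl
    exact h.exists_straightOrderExtension hr hl fun a ha => hGi.le ha
end

section
/- Let S be a semigroup having an embeddable *-pair P = (≤_l, ≤_r). Then there exists an inverse semigroup Q containing S as a subsemigroup such that S is a straight left order in Q and Q induces P, if and only if P satisfies conditions (Gi), (Gii) and (I): for all a,h ∈ G(S), a R' h implies a H' h, and a L' h implies a H' h. -/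
universe u

variable {Q : Type u}

variable {S : Type u}

/-- A semigroup is inverse if every element has a unique (semigroup) inverse. -/
def InverseSemigroup (Q : Type u) [Semigroup Q] : Prop :=
  ∀ q : Q, ∃! q' : Q, q * q' * q = q ∧ q' * q * q' = q'

/-- Condition (I): for all `a, h ∈ G(S)`, `a R' h` implies `a H' h` and `a L' h`
implies `a H' h`. -/
def CondI [Semigroup S] (lel ler : S → S → Prop) : Prop :=
  ∀ a ∈ GS lel ler, ∀ h ∈ GS lel ler,
    (Rp ler a h → Hp lel ler a h) ∧ (Lp lel a h → Hp lel ler a h)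

section StarPairCalculus

variable [Semigroup S] {lel ler : S → S → Prop}

namespace IsEmbeddableStarPair

theorem lp_refl (E : IsEmbeddableStarPair lel ler) (a : S) : Lp lel a a :=
  ⟨E.1.1 a, E.1.1 a⟩

theorem rp_refl (E : IsEmbeddableStarPair lel ler) (a : S) : Rp ler a a :=
  ⟨E.1.2.2.1 a, E.1.2.2.1 a⟩

theorem lel_trans (E : IsEmbeddableStarPair lel ler) {a b c : S} (h : lel a b) (k : lel b c) :
    lel a c := E.1.2.1 a b c h k

theorem ler_trans (E : IsEmbeddableStarPair lel ler) {a b c : S} (h : ler a b) (k : ler b c) :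
    ler a c := E.1.2.2.2.1 a b c h k

theorem lp_trans (E : IsEmbeddableStarPair lel ler) {a b c : S} (h : Lp lel a b)
    (k : Lp lel b c) : Lp lel a c := ⟨E.lel_trans h.1 k.1, E.lel_trans k.2 h.2⟩

theorem rp_trans (E : IsEmbeddableStarPair lel ler) {a b c : S} (h : Rp ler a b)
    (k : Rp ler b c) : Rp ler a c := ⟨E.ler_trans h.1 k.1, E.ler_trans k.2 h.2⟩

theorem hp_trans (E : IsEmbeddableStarPair lel ler) {a b c : S} (h : Hp lel ler a b)
    (k : Hp lel ler b c) : Hp lel ler a c := ⟨E.lp_trans h.1 k.1, E.rp_trans h.2 k.2⟩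

theorem hp_refl (E : IsEmbeddableStarPair lel ler) (a : S) : Hp lel ler a a :=
  ⟨E.lp_refl a, E.rp_refl a⟩

end IsEmbeddableStarPair

theorem Lp.symm {a b : S} (h : Lp lel a b) : Lp lel b a := ⟨h.2, h.1⟩

theorem Rp.symm {a b : S} (h : Rp ler a b) : Rp ler b a := ⟨h.2, h.1⟩

theorem Hp.symm {a b : S} (h : Hp lel ler a b) : Hp lel ler b a := ⟨h.1.symm, h.2.symm⟩

namespace IsEmbeddableStarPair

theorem lel_mul_right (E : IsEmbeddableStarPair lel ler) {a b : S} (h : lel a b) (c : S) :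
    lel (a * c) (b * c) := E.1.2.2.2.2.1 a b c h

theorem lp_mul_right (E : IsEmbeddableStarPair lel ler) {a b : S} (h : Lp lel a b) (c : S) :
    Lp lel (a * c) (b * c) := ⟨E.lel_mul_right h.1 c, E.lel_mul_right h.2 c⟩

theorem rp_mul_left (E : IsEmbeddableStarPair lel ler) {a b : S} (h : Rp ler a b) (c : S) :
    Rp ler (c * a) (c * b) :=
  ⟨E.1.2.2.2.2.2.1 a b c h.1, E.1.2.2.2.2.2.1 b a c h.2⟩

theorem mul_lel (E : IsEmbeddableStarPair lel ler) (d c : S) : lel (d * c) c :=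
  (E.2.2.1 _ _).2 ⟨d, E.lp_refl _⟩

theorem mul_ler (E : IsEmbeddableStarPair lel ler) (c d : S) : ler (c * d) c :=
  (E.2.2.2.1 _ _).2 ⟨d, E.rp_refl _⟩

theorem exists_lp_mul (E : IsEmbeddableStarPair lel ler) {b c : S} (h : lel b c) :
    ∃ d, Lp lel b (d * c) := (E.2.2.1 _ _).1 h

theorem exists_lp (E : IsEmbeddableStarPair lel ler) (a : S) : ∃ g ∈ GS lel ler, Lp lel a g :=
  E.2.2.2.2.1.1 a

theorem exists_rp (E : IsEmbeddableStarPair lel ler) (a : S) : ∃ g ∈ GS lel ler, Rp ler a g :=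
  E.2.2.2.2.1.2 a

theorem exists_rp_lp (E : IsEmbeddableStarPair lel ler) {a b c : S} (h : Lp lel a c)
    (k : Rp ler c b) : ∃ d, Rp ler a d ∧ Lp lel d b := (E.2.1 a b).1 ⟨c, h, k⟩

theorem exists_lp_rp (E : IsEmbeddableStarPair lel ler) {a b c : S} (h : Rp ler a c)
    (k : Lp lel c b) : ∃ d, Lp lel a d ∧ Rp ler d b := (E.2.1 a b).2 ⟨c, h, k⟩

theorem mul_rp (E : IsEmbeddableStarPair lel ler) {a b : S} (ha : a ∈ GS lel ler)
    (h : lel b a) : Rp ler (b * a) b := E.2.2.2.2.2.1 a ha b h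

theorem mul_lp (E : IsEmbeddableStarPair lel ler) {a b : S} (ha : a ∈ GS lel ler)
    (h : ler b a) : Lp lel (a * b) b := E.2.2.2.2.2.2.1 a ha b h

theorem mul_right_cancel_of_lel (E : IsEmbeddableStarPair lel ler) {a b c : S}
    (ha : a ∈ GS lel ler) (hb : lel b a) (hc : lel c a) (h : b * a = c * a) : b = c :=
  E.2.2.2.2.2.2.2.1 a ha b c hb hc h

theorem mul_left_cancel_of_ler (E : IsEmbeddableStarPair lel ler) {a b c : S}
    (ha : a ∈ GS lel ler) (hb : ler b a) (hc : ler c a) (h : a * b = a * c) : b = c :=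
  E.2.2.2.2.2.2.2.2.1 a ha b c hb hc h

theorem rp_of_mul_rp (E : IsEmbeddableStarPair lel ler) {a b c : S}
    (ha : a ∈ GS lel ler) (hb : ler b a) (hc : ler c a) (h : Rp ler (a * b) (a * c)) :
    Rp ler b c := E.2.2.2.2.2.2.2.2.2.2 a ha b c hb hc h

/-- If `L'_p ∩ R'_q` meets `G(S)` then `pq ∈ R'_p ∩ L'_q`. -/
theorem mul_rp_lp (E : IsEmbeddableStarPair lel ler) {p h q : S} (hh : h ∈ GS lel ler)
    (hp : Lp lel p h) (hq : Rp ler h q) : Rp ler (p * q) p ∧ Lp lel (p * q) q :=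
  ⟨E.rp_trans (E.rp_mul_left hq.symm p) (E.mul_rp hh hp.1),
    E.lp_trans (E.lp_mul_right hp q) (E.mul_lp hh hq.2)⟩

theorem mem_GS_of_hp (E : IsEmbeddableStarPair lel ler) {a b : S} (ha : a ∈ GS lel ler)
    (h : Hp lel ler b a) : b ∈ GS lel ler :=
  have k := E.mul_rp_lp ha h.1 h.2.symm
  ⟨k.2.symm, k.1.symm⟩

theorem hp_mul (E : IsEmbeddableStarPair lel ler) {a b c : S} (ha : a ∈ GS lel ler)
    (hb : Hp lel ler b a) (hc : Hp lel ler c a) : Hp lel ler (b * c) a :=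
  have k := E.mul_rp_lp ha hb.1 hc.2.symm
  ⟨E.lp_trans k.2 hc.1, E.rp_trans k.1 hb.2⟩

/-- If `tk ∈ R'_t ∩ L'_k` then `L'_t ∩ R'_k` meets `G(S)`, so condition (I) forces
`t H' k`. -/
theorem hp_of_mul (E : IsEmbeddableStarPair lel ler) (hI : CondI lel ler) {t k : S}
    (ht : t ∈ GS lel ler) (hk : k ∈ GS lel ler) (h₁ : Rp ler (t * k) t)
    (h₂ : Lp lel (t * k) k) : Hp lel ler t k := by
  obtain ⟨w, htw, hwk⟩ := E.exists_lp_rp h₁.symm h₂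
  have hA := E.mul_rp_lp ht htw.symm (E.rp_refl t)
  have hAk : Rp ler k (w * t) := (E.rp_trans hA.1 hwk).symm
  have hg := E.mul_rp_lp hk (E.lp_refl k) hAk
  have hB := E.mul_rp_lp ht htw.symm h₁.symm
  have hBA := E.mul_rp_lp hk (E.lp_trans hB.2 h₂) hAk
  have hgg := E.mul_rp_lp hk (E.lp_refl k)
    (E.rp_trans hBA.1 (E.rp_trans hB.1 hwk)).symm
  have e : k * (w * (t * k) * (w * t)) = k * (w * t) * (k * (w * t)) := by
    simp only [mul_assoc]
  rw [e] at hgg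
  have hgt : Lp lel (k * (w * t)) t := E.lp_trans hg.2 hA.2
  have hG : k * (w * t) ∈ GS lel ler :=
    ⟨E.lp_trans hgt (E.lp_trans hgg.2 (E.lp_trans hBA.2 hA.2)).symm,
      E.rp_trans hg.1 hgg.1.symm⟩
  exact E.hp_trans ((hI _ hG _ ht).2 hgt).symm ((hI _ hG _ hk).1 hg.1)

theorem ler_of_mul_rp (E : IsEmbeddableStarPair lel ler) (hI : CondI lel ler) {k f : S}
    (hk : k ∈ GS lel ler) (h : Rp ler (k * f) k) : ler k f := by
  obtain ⟨q, hq, hkq⟩ := E.exists_lp (k * f)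
  have hfq : Lp lel (f * q) q := by
    refine ⟨E.mul_lel f q, ?_⟩
    have h1 := E.lel_trans hq.1.1 (E.lel_mul_right hkq.2 q)
    rw [mul_assoc] at h1
    exact E.lel_trans h1 (E.mul_lel k (f * q))
  obtain ⟨r, hr, hfr⟩ := E.exists_rp (f * q)
  obtain ⟨s, hqs, hsr⟩ := E.exists_rp_lp hfq.symm hfr
  have h2 := E.mul_rp_lp hq hkq (E.rp_refl q)
  have h3 := E.mul_rp_lp hq h2.2 hqs
  have h4 := E.mul_rp_lp hq hfq hqs
  have hj : Hp lel ler (f * q * s) r := ⟨E.lp_trans h4.2 hsr, E.rp_trans h4.1 hfr⟩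
  have e : k * f * q * s = k * (f * q * s) := by simp only [mul_assoc]
  rw [e] at h3
  have h5 := E.hp_of_mul hI hk (E.mem_GS_of_hp hr hj)
    (E.rp_trans h3.1 (E.rp_trans h2.1 h)) (E.lp_trans h3.2 h4.2.symm)
  exact E.ler_trans (E.rp_trans h5.2 h4.1).1 (E.mul_ler f q)

theorem lel_of_mul_lp (E : IsEmbeddableStarPair lel ler) (hI : CondI lel ler) {k f : S}
    (hk : k ∈ GS lel ler) (h : Lp lel (f * k) k) : lel k f := by
  obtain ⟨q, hq, hkq⟩ := E.exists_rp (f * k)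
  have hqf : Rp ler (q * f) q := by
    refine ⟨E.mul_ler q f, ?_⟩
    have h1 := E.ler_trans hq.2.1 (E.rp_mul_left hkq q).2
    rw [← mul_assoc] at h1
    exact E.ler_trans h1 (E.mul_ler (q * f) k)
  obtain ⟨r, hr, hfr⟩ := E.exists_lp (q * f)
  obtain ⟨s, hrs, hsq⟩ := E.exists_rp_lp hfr.symm hqf
  have h2 := E.mul_rp_lp hq (E.lp_refl q) hkq.symm
  have h3 := E.mul_rp_lp hq hsq h2.1.symm
  have h4 := E.mul_rp_lp hq hsq hqf.symm
  have hj : Hp lel ler (s * (q * f)) r := ⟨E.lp_trans h4.2 hfr, E.rp_trans h4.1 hrs.symm⟩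
  have e : s * (q * (f * k)) = s * (q * f) * k := by simp only [mul_assoc]
  rw [e] at h3
  have h5 := E.hp_of_mul hI (E.mem_GS_of_hp hr hj) hk
    (E.rp_trans h3.1 h4.1.symm) (E.lp_trans h3.2 (E.lp_trans h2.2 h))
  exact E.lel_trans (E.lp_trans h5.1.symm h4.2).1 (E.mul_lel q f)

theorem ler_of_lel (E : IsEmbeddableStarPair lel ler) (hI : CondI lel ler) {k f : S}
    (hk : k ∈ GS lel ler) (hf : f ∈ GS lel ler) (h : lel k f) : ler k f :=
  E.ler_of_mul_rp hI hk (E.mul_rp hf h)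

theorem lel_of_ler (E : IsEmbeddableStarPair lel ler) (hI : CondI lel ler) {k f : S}
    (hk : k ∈ GS lel ler) (hf : f ∈ GS lel ler) (h : ler k f) : lel k f :=
  E.lel_of_mul_lp hI hk (E.mul_lp hf h)

/-- `zd R' z` holds exactly when `z` lies `≤_l`-below the `G(S)`-elements of `R'_d`. -/
theorem mul_rp_iff (E : IsEmbeddableStarPair lel ler) (hI : CondI lel ler) {z d g : S}
    (hg : g ∈ GS lel ler) (hd : Rp ler d g) : Rp ler (z * d) z ↔ lel z g := by
  constructor
  · intro h
    have hz : Rp ler (z * g) z := E.rp_trans (E.rp_mul_left hd.symm z) h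
    obtain ⟨k, hk, hzk⟩ := E.exists_lp z
    obtain ⟨a, ha, hza⟩ := E.exists_rp z
    obtain ⟨s, hks, hsa⟩ := E.exists_rp_lp hzk.symm hza
    have h1 := E.mul_rp_lp ha hsa hza.symm
    have hG : s * z ∈ GS lel ler :=
      E.mem_GS_of_hp hk ⟨E.lp_trans h1.2 hzk, E.rp_trans h1.1 hks.symm⟩
    have h2 : Rp ler (s * z * g) (s * z) := by
      rw [mul_assoc]; exact E.rp_mul_left hz s
    exact E.lel_trans h1.2.2 (E.lel_of_ler hI hG hg (E.ler_of_mul_rp hI hG h2))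
  · intro h
    exact E.rp_trans (E.rp_mul_left hd z) (E.mul_rp hg h)

theorem mul_right_cancel_of_rp (E : IsEmbeddableStarPair lel ler) (hI : CondI lel ler)
    {z w c : S} (hz : Rp ler (z * c) z) (hw : Rp ler (w * c) w) (h : z * c = w * c) :
    z = w := by
  obtain ⟨g, hg, hcg⟩ := E.exists_rp c
  obtain ⟨k, hk, hck⟩ := E.exists_lp c
  obtain ⟨s, hks, hsg⟩ := E.exists_rp_lp hck.symm hcg
  have h1 := E.mul_rp_lp hk hck hks
  have hH : Hp lel ler (c * s) g := ⟨E.lp_trans h1.2 hsg, E.rp_trans h1.1 hcg⟩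
  have hG := E.mem_GS_of_hp hg hH
  refine E.mul_right_cancel_of_lel hG ?_ ?_ (by rw [← mul_assoc, h, mul_assoc])
  · exact E.lel_trans ((E.mul_rp_iff hI hg hcg).1 hz) hH.1.2
  · exact E.lel_trans ((E.mul_rp_iff hI hg hcg).1 hw) hH.1.2

theorem exists_mul_hp (E : IsEmbeddableStarPair lel ler) {b c : S} (h : lel b c) :
    ∃ y, Rp ler y b ∧ Hp lel ler (y * c) b := by
  obtain ⟨g, hg, hcg⟩ := E.exists_rp c
  obtain ⟨d, hd⟩ := E.exists_lp_mul (E.lel_trans h (E.mul_lp hg hcg.1).2)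
  rw [← mul_assoc] at hd
  have h0 : ∀ y, lel y g → Rp ler (y * c) y := fun y hy =>
    E.rp_trans (E.rp_mul_left hcg y) (E.mul_rp hg hy)
  obtain ⟨y, hby, hyd⟩ := E.exists_rp_lp hd (h0 _ (E.mul_lel d g))
  exact ⟨y, hby.symm, E.lp_trans (E.lp_mul_right hyd c) hd.symm,
    E.rp_trans (h0 y (E.lel_trans hyd.1 (E.mul_lel d g))) hby.symm⟩

end IsEmbeddableStarPair

/-- The hypotheses under which an inverse semigroup of straight left quotients is built. -/
structure IsInversePair (lel ler : S → S → Prop) : Prop where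
  emb : IsEmbeddableStarPair lel ler
  gi : CondGi lel ler
  gii : CondGii lel ler
  i : CondI lel ler

namespace IsInversePair

theorem reversible (A : IsInversePair lel ler) {a x y : S} (ha : a ∈ GS lel ler)
    (hx : Hp lel ler x a) (hy : Hp lel ler y a) :
    ∃ u v, Hp lel ler u a ∧ Hp lel ler v a ∧ u * x = v * y :=
  A.gii a (A.gi.symm ▸ ha) x y hx hy

theorem exists_mul_eq_mul (A : IsInversePair lel ler) {a z w : S} (ha : a ∈ GS lel ler)
    (haz : Rp ler a z) (h : Hp lel ler z w) :
    ∃ u v, Hp lel ler u a ∧ Hp lel ler v a ∧ u * z = v * w := by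
  have E := A.emb
  obtain ⟨p, hp, hzp⟩ := E.exists_lp z
  obtain ⟨s, hps, hsa⟩ := E.exists_rp_lp hzp.symm haz.symm
  have h1 := E.mul_rp_lp ha hsa haz
  have h2 := E.mul_rp_lp ha hsa (E.rp_trans haz h.2)
  obtain ⟨u, v, hu, hv, e⟩ := A.reversible hp
    ⟨E.lp_trans h1.2 hzp, E.rp_trans h1.1 hps.symm⟩
    ⟨E.lp_trans h2.2 (E.lp_trans h.1.symm hzp), E.rp_trans h2.1 hps.symm⟩
  have key : ∀ t, Hp lel ler t p → Hp lel ler (z * t * s) a := fun t ht => by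
    have h3 := E.mul_rp_lp hp hzp ht.2.symm
    have h4 := E.mul_rp_lp hp (E.lp_trans h3.2 ht.1) hps
    exact ⟨E.lp_trans h4.2 hsa, E.rp_trans h4.1 (E.rp_trans h3.1 haz.symm)⟩
  exact ⟨_, _, key u hu, key v hv, by simpa only [mul_assoc] using congrArg (z * ·) e⟩

/-- Any two elements have a greatest lower bound for `≤_l`. -/
theorem exists_meet (A : IsInversePair lel ler) (b c : S) :
    ∃ m, ∀ w, lel w m ↔ lel w b ∧ lel w c := by
  have E := A.emb
  obtain ⟨a, ha, hba⟩ := E.exists_lp b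
  obtain ⟨h, hh, hch⟩ := E.exists_lp c
  obtain ⟨n, hn, hahn⟩ := E.exists_rp (a * h)
  have hna : Rp ler (n * a) n :=
    E.mul_rp ha (E.lel_of_ler A.i hn ha (E.ler_trans hahn.2 (E.mul_ler a h)))
  have hnh : lel (n * a) h := by
    rw [← E.mul_rp_iff A.i hh (E.rp_refl h), mul_assoc]
    exact E.rp_trans (E.rp_mul_left hahn n) (E.rp_trans hn.2.symm hna.symm)
  refine ⟨n * a, fun w => ⟨fun hw => ⟨?_, ?_⟩, fun ⟨hwb, hwc⟩ => ?_⟩⟩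
  · exact E.lel_trans hw (E.lel_trans (E.mul_lel n a) hba.2)
  · exact E.lel_trans hw (E.lel_trans hnh hch.2)
  · obtain ⟨y, hyw, hya⟩ := E.exists_mul_hp (E.lel_trans hwb hba.1)
    have h1 : Rp ler (y * a * h) (y * a) := (E.mul_rp_iff A.i hh (E.rp_refl h)).2
      (E.lel_trans hya.1.1 (E.lel_trans hwc hch.1))
    rw [mul_assoc] at h1
    have h2 : lel y n := (E.mul_rp_iff A.i hn hahn).1
      (E.rp_trans h1 (E.rp_trans hya.2 hyw.symm))
    exact E.lel_trans hya.1.2 (E.lel_mul_right h2 a)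

/-- The left Ore condition for straight fractions. -/
theorem exists_ore (A : IsInversePair lel ler) (b c : S) :
    ∃ x y, x * b = y * c ∧ ∀ w, lel w b → lel w c → lel w (x * b) := by
  have E := A.emb
  obtain ⟨m, hm⟩ := A.exists_meet b c
  have hmm := (hm m).1 (E.lp_refl m).1
  obtain ⟨x, -, hxb⟩ := E.exists_mul_hp hmm.1
  obtain ⟨y, -, hyc⟩ := E.exists_mul_hp hmm.2
  obtain ⟨a, ha, hma⟩ := E.exists_rp m
  obtain ⟨u, v, hu, hv, e⟩ := A.exists_mul_eq_mul ha (E.rp_trans hxb.2 hma).symm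
    (E.hp_trans hxb hyc.symm)
  have h1 := E.mul_rp_lp ha hu.1 (E.rp_trans hxb.2 hma).symm
  refine ⟨u * x, v * y, by simpa only [mul_assoc] using e, fun w hb hc => ?_⟩
  rw [mul_assoc]
  exact E.lel_trans ((hm w).2 ⟨hb, hc⟩) (E.lp_trans h1.2 hxb.1).2

end IsInversePair

/-- Pairs `(a, b)` with `a ∈ G(S)` and `a R' b`, standing for the fractions `a♯b`. -/
def FracPair (lel ler : S → S → Prop) : Type _ :=
  { p : S × S // p.1 ∈ GS lel ler ∧ Rp ler p.1 p.2 }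

namespace IsInversePair

/-- Equality of the fractions represented by two pairs. -/
def fracSetoid (A : IsInversePair lel ler) : Setoid (FracPair lel ler) where
  r p q := Hp lel ler p.1.1 q.1.1 ∧ ∃ u v, Hp lel ler u p.1.1 ∧ Hp lel ler v p.1.1 ∧
    u * p.1.1 = v * q.1.1 ∧ u * p.1.2 = v * q.1.2
  iseqv := by
    have E := A.emb
    refine ⟨fun p => ⟨E.hp_refl _, p.1.1, p.1.1, E.hp_refl _, E.hp_refl _, rfl, rfl⟩, ?_, ?_⟩
    · rintro p q ⟨h, u, v, hu, hv, e₁, e₂⟩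
      exact ⟨h.symm, v, u, E.hp_trans hv h, E.hp_trans hu h, e₁.symm, e₂.symm⟩
    · rintro p q r ⟨h, u, v, hu, hv, e₁, e₂⟩ ⟨h', u', v', hu', hv', e₁', e₂'⟩
      obtain ⟨s, t, hs, ht, e⟩ := A.reversible p.2.1 hv (E.hp_trans hu' h.symm)
      refine ⟨E.hp_trans h h', s * u, t * v', E.hp_mul p.2.1 hs hu,
        E.hp_mul p.2.1 ht (E.hp_trans hv' h.symm), ?_, ?_⟩
      · rw [mul_assoc, e₁, ← mul_assoc, e, mul_assoc, e₁', mul_assoc]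
      · rw [mul_assoc, e₂, ← mul_assoc, e, mul_assoc, e₂', mul_assoc]

/-- The set of fractions `a♯b`. -/
def Fraction (A : IsInversePair lel ler) : Type _ := Quotient A.fracSetoid

/-- The fraction represented by a pair. -/
def frac (A : IsInversePair lel ler) (p : FracPair lel ler) : A.Fraction := Quotient.mk _ p

theorem exists_frac (A : IsInversePair lel ler) (x : A.Fraction) : ∃ p, x = A.frac p := by
  obtain ⟨p, hp⟩ := Quotient.exists_rep x
  exact ⟨p, hp.symm⟩

theorem frac_eq_iff (A : IsInversePair lel ler) {p q : FracPair lel ler} :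
    A.frac p = A.frac q ↔ Hp lel ler p.1.1 q.1.1 ∧ ∃ u v, Hp lel ler u p.1.1 ∧
      Hp lel ler v p.1.1 ∧ u * p.1.1 = v * q.1.1 ∧ u * p.1.2 = v * q.1.2 :=
  ⟨fun h => Quotient.exact h, fun h => Quotient.sound (s := A.fracSetoid) h⟩

/-- The partial action of `c ∈ S` on fractions by right multiplication: it sends `a♯b` to
`a♯(bc)` when `b R' bc`. -/
def act (A : IsInversePair lel ler) (c : S) (x y : A.Fraction) : Prop :=
  ∃ p q : FracPair lel ler, x = A.frac p ∧ y = A.frac q ∧ q.1.1 = p.1.1 ∧ q.1.2 = p.1.2 * c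

theorem act_frac_iff (A : IsInversePair lel ler) {c : S} {p : FracPair lel ler}
    {y : A.Fraction} :
    A.act c (A.frac p) y ↔ ∃ h : Rp ler p.1.1 (p.1.2 * c),
      y = A.frac ⟨(p.1.1, p.1.2 * c), p.2.1, h⟩ := by
  have E := A.emb
  constructor
  · rintro ⟨p', ⟨⟨a, b⟩, ha, hab⟩, hp, rfl, e₁, e₂⟩
    simp only at e₁ e₂ ha hab
    subst e₁ e₂
    obtain ⟨h, u, v, hu, hv, e₁, e₂⟩ := A.frac_eq_iff.1 hp
    have huG := E.mem_GS_of_hp p.2.1 hu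
    have hvp : Rp ler p'.1.2 (p'.1.2 * c) := E.rp_trans p'.2.2.symm hab
    have h1 := E.rp_mul_left hvp v
    rw [← mul_assoc, ← e₂, mul_assoc] at h1
    have hpu : Rp ler p.1.2 u := (E.rp_trans hu.2 p.2.2).symm
    have h2 := E.rp_of_mul_rp huG hpu.1 (E.ler_trans (E.mul_ler _ c) hpu.1) h1
    refine ⟨E.rp_trans p.2.2 h2, Eq.symm (A.frac_eq_iff.2 ?_)⟩
    exact ⟨h, u, v, hu, hv, e₁, by simp only [← mul_assoc, e₂]⟩
  · rintro ⟨h, rfl⟩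
    exact ⟨p, _, rfl, rfl, rfl, rfl⟩

theorem act_unique (A : IsInversePair lel ler) {c : S} {x y y' : A.Fraction}
    (h : A.act c x y) (h' : A.act c x y') : y = y' := by
  obtain ⟨p, rfl⟩ := A.exists_frac x
  obtain ⟨_, rfl⟩ := A.act_frac_iff.1 h
  obtain ⟨_, rfl⟩ := A.act_frac_iff.1 h'
  rfl

theorem act_injective (A : IsInversePair lel ler) {c : S} {x x' y : A.Fraction}
    (h : A.act c x y) (h' : A.act c x' y) : x = x' := by
  have E := A.emb
  obtain ⟨p, rfl⟩ := A.exists_frac x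
  obtain ⟨p', rfl⟩ := A.exists_frac x'
  obtain ⟨k, rfl⟩ := A.act_frac_iff.1 h
  obtain ⟨k', e⟩ := A.act_frac_iff.1 h'
  obtain ⟨h, u, v, hu, hv, e₁, e₂⟩ := A.frac_eq_iff.1 e
  refine A.frac_eq_iff.2 ⟨h, u, v, hu, hv, e₁, ?_⟩
  simp only [← mul_assoc] at e₂
  refine E.mul_right_cancel_of_rp A.i ?_ ?_ e₂
  · rw [mul_assoc]
    exact E.rp_mul_left (E.rp_trans k.symm p.2.2) u
  · rw [mul_assoc]
    exact E.rp_mul_left (E.rp_trans k'.symm p'.2.2) v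

theorem act_mul (A : IsInversePair lel ler) {c d : S} {x z : A.Fraction} :
    A.act (c * d) x z ↔ ∃ y, A.act c x y ∧ A.act d y z := by
  have E := A.emb
  obtain ⟨p, rfl⟩ := A.exists_frac x
  constructor
  · intro h
    obtain ⟨k, rfl⟩ := A.act_frac_iff.1 h
    have k' : Rp ler p.1.1 (p.1.2 * c * d) := by rw [mul_assoc]; exact k
    have k'' : Rp ler p.1.1 (p.1.2 * c) :=
      ⟨E.ler_trans k'.1 (E.mul_ler _ d), E.ler_trans (E.mul_ler _ c) p.2.2.2⟩
    refine ⟨_, A.act_frac_iff.2 ⟨k'', rfl⟩, A.act_frac_iff.2 ⟨k', ?_⟩⟩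
    simp only [mul_assoc]
  · rintro ⟨y, h, h'⟩
    obtain ⟨k, rfl⟩ := A.act_frac_iff.1 h
    obtain ⟨k', rfl⟩ := A.act_frac_iff.1 h'
    simp only [mul_assoc] at k'
    refine A.act_frac_iff.2 ⟨k', ?_⟩
    simp only [mul_assoc]

theorem act_dom_iff (A : IsInversePair lel ler) {c g : S} (hg : g ∈ GS lel ler)
    (hc : Rp ler c g) {p : FracPair lel ler} :
    (∃ y, A.act c (A.frac p) y) ↔ lel p.1.2 g := by
  have E := A.emb
  rw [← E.mul_rp_iff A.i hg hc]
  constructor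
  · rintro ⟨y, h⟩
    obtain ⟨k, -⟩ := A.act_frac_iff.1 h
    exact E.rp_trans k.symm p.2.2
  · intro h
    exact ⟨_, A.act_frac_iff.2 ⟨E.rp_trans p.2.2 h.symm, rfl⟩⟩

theorem act_image_iff (A : IsInversePair lel ler) {c : S} {p : FracPair lel ler} :
    (∃ x, A.act c x (A.frac p)) ↔ lel p.1.2 c := by
  have E := A.emb
  constructor
  · rintro ⟨x, h⟩
    obtain ⟨q, rfl⟩ := A.exists_frac x
    obtain ⟨k, e⟩ := A.act_frac_iff.1 h
    obtain ⟨h, u, v, hu, hv, -, e₂⟩ := A.frac_eq_iff.1 e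
    have h1 := (E.mul_rp_lp p.2.1 hu.1 p.2.2).2
    rw [e₂] at h1
    exact E.lel_trans h1.2 (E.lel_trans (E.mul_lel v _) (E.mul_lel _ c))
  · intro h
    obtain ⟨y, hy, hyc⟩ := E.exists_mul_hp h
    obtain ⟨u, v, hu, hv, e⟩ := A.exists_mul_eq_mul p.2.1 p.2.2 hyc.symm
    have hG := p.2.1
    have hpy : Rp ler p.1.1 y := E.rp_trans p.2.2 hy.symm
    have hpyc : Rp ler p.1.1 (y * c) := E.rp_trans p.2.2 hyc.2.symm
    have hup := E.hp_mul hG hu (E.hp_refl _)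
    have hvy : ∀ z, Rp ler p.1.1 z → Rp ler (u * p.1.1) (v * z) := fun z hz =>
      E.rp_trans hup.2 (E.rp_trans (E.mul_rp_lp hG hv.1 hz).1 hv.2).symm
    have hk := hvy _ hpyc
    rw [← mul_assoc] at hk
    refine ⟨A.frac ⟨(u * p.1.1, v * y), E.mem_GS_of_hp hG hup, hvy _ hpy⟩,
      A.act_frac_iff.2 ⟨hk, A.frac_eq_iff.2 ⟨hup.symm, p.1.1 * u, p.1.1,
        E.hp_mul hG (E.hp_refl _) hu, E.hp_refl _, ?_, ?_⟩⟩⟩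
    · simp only [mul_assoc]
    · simp only [mul_assoc, e]

theorem act_dom_mono (A : IsInversePair lel ler) {c d : S} (h : ler c d) {x y : A.Fraction}
    (hx : A.act c x y) : ∃ z, A.act d x z := by
  have E := A.emb
  obtain ⟨p, rfl⟩ := A.exists_frac x
  obtain ⟨g, hg, hcg⟩ := E.exists_rp c
  obtain ⟨k, hk, hdk⟩ := E.exists_rp d
  exact (A.act_dom_iff hk hdk).2 (E.lel_trans ((A.act_dom_iff hg hcg).1 ⟨y, hx⟩)
    (E.lel_of_ler A.i hg hk (E.ler_trans hcg.2 (E.ler_trans h hdk.1))))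

theorem act_image_mono (A : IsInversePair lel ler) {c d : S} (h : lel c d)
    {x y : A.Fraction} (hx : A.act c x y) : ∃ z, A.act d z y := by
  obtain ⟨p, rfl⟩ := A.exists_frac y
  exact A.act_image_iff.2 (A.emb.lel_trans (A.act_image_iff.1 ⟨x, hx⟩) h)

theorem ler_of_act_dom (A : IsInversePair lel ler) {c d : S}
    (h : ∀ x y, A.act c x y → ∃ z, A.act d x z) : ler c d := by
  have E := A.emb
  obtain ⟨g, hg, hcg⟩ := E.exists_rp c
  obtain ⟨k, hk, hdk⟩ := E.exists_rp d
  obtain ⟨y, hy⟩ := (A.act_dom_iff hg hcg (p := ⟨(g, g), hg, E.rp_refl g⟩)).2 (E.lp_refl g).1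
  have h1 : lel g k := (A.act_dom_iff hk hdk).1 (h _ _ hy)
  exact E.ler_trans hcg.1 (E.ler_trans (E.ler_of_lel A.i hg hk h1) hdk.2)

theorem lel_of_act_image (A : IsInversePair lel ler) {c d : S}
    (h : ∀ x y, A.act c x y → ∃ z, A.act d z y) : lel c d := by
  have E := A.emb
  obtain ⟨g, hg, hcg⟩ := E.exists_lp c
  obtain ⟨x, hx⟩ := (A.act_image_iff (p := ⟨(g, g), hg, E.rp_refl g⟩)).2 hcg.2
  exact E.lel_trans hcg.1 (A.act_image_iff.1 (h _ _ hx))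

theorem act_faithful (A : IsInversePair lel ler) {c d : S} (h : A.act c = A.act d) :
    c = d := by
  have E := A.emb
  have hcd : Rp ler c d := ⟨A.ler_of_act_dom fun x y hx => ⟨y, h ▸ hx⟩,
    A.ler_of_act_dom fun x y hx => ⟨y, h ▸ hx⟩⟩
  obtain ⟨g, hg, hcg⟩ := E.exists_rp c
  obtain ⟨y, hy⟩ := (A.act_dom_iff hg hcg (p := ⟨(g, g), hg, E.rp_refl g⟩)).2 (E.lp_refl g).1
  obtain ⟨k, rfl⟩ := A.act_frac_iff.1 hy
  rw [h] at hy
  obtain ⟨k', e⟩ := A.act_frac_iff.1 hy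
  obtain ⟨-, u, v, hu, hv, e₁, e₂⟩ := A.frac_eq_iff.1 e
  simp only at hu hv e₁ e₂
  obtain rfl := E.mul_right_cancel_of_lel hg hu.1.1 hv.1.1 e₁
  have hug := E.hp_mul hg hu (E.hp_refl g)
  rw [← mul_assoc, ← mul_assoc] at e₂
  exact E.mul_left_cancel_of_ler (E.mem_GS_of_hp hg hug) (E.rp_trans hcg hug.2.symm).1
    (E.rp_trans hcd.symm (E.rp_trans hcg hug.2.symm)).1 e₂

/-- The partial injection of the set of fractions that represents `a⁻¹b`. -/
def quot (A : IsInversePair lel ler) (a b : S) (x y : A.Fraction) : Prop :=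
  ∃ w, A.act a w x ∧ A.act b w y

theorem exists_quot_comp (A : IsInversePair lel ler) {a b c d : S} (hab : Rp ler a b)
    (hcd : Rp ler c d) :
    ∃ a' b', Rp ler a' b' ∧ Relation.Comp (A.quot a b) (A.quot c d) = A.quot a' b' := by
  have E := A.emb
  obtain ⟨x, y, e, hm⟩ := A.exists_ore b c
  have h1 := E.rp_mul_left hab x
  have h2 := E.rp_mul_left hcd y
  have h3 : Rp ler (x * b) (y * c) := e ▸ E.rp_refl _
  refine ⟨x * a, y * d, E.rp_trans h1 (E.rp_trans h3 h2), ?_⟩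
  funext s t
  refine propext ⟨?_, ?_⟩
  · rintro ⟨r, ⟨w₁, ha, hb⟩, ⟨w₂, hc, hd⟩⟩
    obtain ⟨p, rfl⟩ := A.exists_frac r
    obtain ⟨w, hw⟩ := A.act_image_iff.2
      (hm _ (A.act_image_iff.1 ⟨w₁, hb⟩) (A.act_image_iff.1 ⟨w₂, hc⟩))
    obtain ⟨z₁, hz₁, hz₁'⟩ := A.act_mul.1 hw
    rw [e] at hw
    obtain ⟨z₂, hz₂, hz₂'⟩ := A.act_mul.1 hw
    obtain rfl := A.act_injective hb hz₁'
    obtain rfl := A.act_injective hc hz₂'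
    exact ⟨w, A.act_mul.2 ⟨_, hz₁, ha⟩, A.act_mul.2 ⟨_, hz₂, hd⟩⟩
  · rintro ⟨w, hs, ht⟩
    obtain ⟨w₁, hw₁, ha⟩ := A.act_mul.1 hs
    obtain ⟨w₂, hw₂, hd⟩ := A.act_mul.1 ht
    obtain ⟨r, hb⟩ := A.act_dom_mono hab.1 ha
    obtain ⟨r', hc⟩ := A.act_dom_mono hcd.2 hd
    have k₁ := A.act_mul.2 ⟨_, hw₁, hb⟩
    have k₂ := A.act_mul.2 ⟨_, hw₂, hc⟩
    rw [e] at k₁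
    obtain rfl := A.act_unique k₁ k₂
    exact ⟨r, ⟨w₁, ha, hb⟩, ⟨w₂, hc, hd⟩⟩

/-- The inverse semigroup of straight left quotients, as partial injections. -/
def Quotients (A : IsInversePair lel ler) : Type _ :=
  { r : A.Fraction → A.Fraction → Prop // ∃ a b, Rp ler a b ∧ r = A.quot a b }

instance (A : IsInversePair lel ler) : Semigroup A.Quotients where
  mul r s := ⟨Relation.Comp r.1 s.1, by
    obtain ⟨_, a, b, hab, rfl⟩ := r
    obtain ⟨_, c, d, hcd, rfl⟩ := s
    exact A.exists_quot_comp hab hcd⟩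
  mul_assoc _ _ _ := Subtype.ext Relation.comp_assoc

theorem quotients_unique (A : IsInversePair lel ler) (r : A.Quotients) {x y z : A.Fraction}
    (hy : r.1 x y) (hz : r.1 x z) : y = z := by
  obtain ⟨_, a, b, hab, rfl⟩ := r
  obtain ⟨w, h₁, h₂⟩ := hy
  obtain ⟨w', h₁', h₂'⟩ := hz
  obtain rfl := A.act_injective h₁ h₁'
  exact A.act_unique h₂ h₂'

/-- The inverse of a quotient. -/
def inv (A : IsInversePair lel ler) (r : A.Quotients) : A.Quotients :=
  ⟨fun x y => r.1 y x, by
    obtain ⟨_, a, b, hab, rfl⟩ := r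
    refine ⟨b, a, hab.symm, ?_⟩
    funext x y
    exact propext ⟨fun ⟨w, h, k⟩ => ⟨w, k, h⟩, fun ⟨w, h, k⟩ => ⟨w, k, h⟩⟩⟩

theorem quotients_injective (A : IsInversePair lel ler) (r : A.Quotients)
    {x y z : A.Fraction} (hx : r.1 x z) (hy : r.1 y z) : x = y :=
  A.quotients_unique (A.inv r) hx hy

theorem mul_inv_mul (A : IsInversePair lel ler) (r : A.Quotients) :
    r * A.inv r * r = r := by
  refine Subtype.ext (funext fun x => funext fun y => propext ⟨?_, fun h => ?_⟩)
  · rintro ⟨z, ⟨w, h₁, h₂⟩, h₃⟩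
    obtain rfl := A.quotients_injective r h₁ h₂
    exact h₃
  · exact ⟨x, ⟨y, h, h⟩, h⟩

theorem inv_val_le_of_mul_mul (A : IsInversePair lel ler) {r s : A.Quotients}
    (h : r * s * r = r) {x y : A.Fraction} (hx : r.1 x y) : s.1 y x := by
  have k := hx
  rw [← h] at k
  obtain ⟨z, ⟨w, h₁, h₂⟩, h₃⟩ := k
  obtain rfl := A.quotients_unique r hx h₁
  obtain rfl := A.quotients_injective r hx h₃
  exact h₂

theorem inverseSemigroup_quotients (A : IsInversePair lel ler) :
    InverseSemigroup A.Quotients := fun r =>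
  ⟨A.inv r, ⟨A.mul_inv_mul r, A.mul_inv_mul (A.inv r)⟩, fun _ hs =>
    Subtype.ext (funext fun _ => funext fun _ => propext
      ⟨A.inv_val_le_of_mul_mul hs.2, A.inv_val_le_of_mul_mul hs.1⟩)⟩

/-- The embedding of `S` in its inverse semigroup of straight left quotients. -/
def embed (A : IsInversePair lel ler) (c : S) : A.Quotients :=
  ⟨A.act c, by
    have E := A.emb
    obtain ⟨g, hg, hcg⟩ := E.exists_rp c
    refine ⟨g, g * c, (E.mul_rp_lp hg (E.lp_refl g) hcg.symm).1.symm, ?_⟩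
    funext x y
    refine propext ⟨fun h => ?_, ?_⟩
    · obtain ⟨z, hz⟩ := A.act_dom_mono hcg.1 h
      obtain ⟨p, rfl⟩ := A.exists_frac x
      obtain ⟨w, hw⟩ := A.act_image_iff.2 ((A.act_dom_iff hg (E.rp_refl g)).1 ⟨z, hz⟩)
      exact ⟨w, hw, A.act_mul.2 ⟨_, hw, h⟩⟩
    · rintro ⟨w, hw, h⟩
      obtain ⟨x', hx', h'⟩ := A.act_mul.1 h
      obtain rfl := A.act_unique hw hx'
      exact h'⟩

theorem embed_mul (A : IsInversePair lel ler) (c d : S) :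
    A.embed (c * d) = A.embed c * A.embed d :=
  Subtype.ext (funext fun _ => funext fun _ => propext A.act_mul)

theorem lel_iff (A : IsInversePair lel ler) (b c : S) :
    lel b c ↔ leL (A.embed b) (A.embed c) := by
  constructor
  · intro h
    refine Or.inr ⟨A.embed b * A.inv (A.embed c), ?_⟩
    refine Subtype.ext (funext fun x => funext fun y => propext ⟨fun hb => ?_, ?_⟩)
    · obtain ⟨z, hz⟩ := A.act_image_mono h hb
      exact ⟨z, ⟨y, hb, hz⟩, hz⟩
    · rintro ⟨z, ⟨w, h₁, h₂⟩, h₃⟩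
      obtain rfl := A.act_unique h₂ h₃
      exact h₁
  · intro h
    refine A.lel_of_act_image fun x y hb => ?_
    change (A.embed b).1 x y at hb
    rcases h with h | ⟨r, h⟩ <;> rw [h] at hb
    · exact ⟨x, hb⟩
    · obtain ⟨z, -, hz⟩ := hb
      exact ⟨z, hz⟩

theorem ler_iff (A : IsInversePair lel ler) (b c : S) :
    ler b c ↔ leR (A.embed b) (A.embed c) := by
  constructor
  · intro h
    refine Or.inr ⟨A.inv (A.embed c) * A.embed b, ?_⟩
    refine Subtype.ext (funext fun x => funext fun y => propext ⟨fun hb => ?_, ?_⟩)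
    · obtain ⟨z, hz⟩ := A.act_dom_mono h hb
      exact ⟨z, hz, x, hz, hb⟩
    · rintro ⟨z, h₁, w, h₂, h₃⟩
      obtain rfl := A.act_injective h₁ h₂
      exact h₃
  · intro h
    refine A.ler_of_act_dom fun x y hb => ?_
    change (A.embed b).1 x y at hb
    rcases h with h | ⟨r, h⟩ <;> rw [h] at hb
    · exact ⟨y, hb⟩
    · obtain ⟨z, hz, -⟩ := hb
      exact ⟨z, hz⟩

theorem isGroupInverse_inv_embed (A : IsInversePair lel ler) {a : S} (ha : a ∈ GS lel ler) :
    IsGroupInverse (A.embed a) (A.inv (A.embed a)) := by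
  refine ⟨?_, A.mul_inv_mul _, A.mul_inv_mul (A.inv (A.embed a))⟩
  have key : ∀ x, (∃ y, A.act a x y) ↔ ∃ y, A.act a y x := fun x => by
    obtain ⟨p, rfl⟩ := A.exists_frac x
    rw [A.act_image_iff, A.act_dom_iff ha (A.emb.rp_refl a)]
  refine Subtype.ext (funext fun x => funext fun y => propext ⟨?_, ?_⟩)
  · rintro ⟨z, h₁, h₂⟩
    obtain rfl := A.act_injective h₁ h₂
    obtain ⟨w, hw⟩ := (key x).1 ⟨z, h₁⟩
    exact ⟨w, hw, hw⟩
  · rintro ⟨z, h₁, h₂⟩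
    obtain rfl := A.act_unique h₁ h₂
    obtain ⟨w, hw⟩ := (key x).2 ⟨z, h₁⟩
    exact ⟨w, hw, hw⟩

/-- Every quotient `a⁻¹b` can be written with `a ∈ G(S)`. -/
theorem exists_quot_eq (A : IsInversePair lel ler) {a b : S} (hab : Rp ler a b) :
    ∃ c ∈ GS lel ler, ∃ d, Rp ler c d ∧ A.quot a b = A.quot c d := by
  have E := A.emb
  obtain ⟨p, hp, hap⟩ := E.exists_lp a
  obtain ⟨g, hg, hag⟩ := E.exists_rp a
  obtain ⟨s, hps, hsg⟩ := E.exists_rp_lp hap.symm hag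
  have h1 := E.mul_rp_lp hg hsg hag.symm
  have hG := E.mem_GS_of_hp hp ⟨E.lp_trans h1.2 hap, E.rp_trans h1.1 hps.symm⟩
  refine ⟨s * a, hG, s * b, E.rp_mul_left hab s, ?_⟩
  funext x y
  refine propext ⟨?_, ?_⟩
  · rintro ⟨w, h, h'⟩
    obtain ⟨q, rfl⟩ := A.exists_frac w
    obtain ⟨z, hz⟩ := A.act_image_iff.2
      (E.lel_trans ((A.act_dom_iff hg hag).1 ⟨x, h⟩) hsg.2)
    exact ⟨z, A.act_mul.2 ⟨_, hz, h⟩, A.act_mul.2 ⟨_, hz, h'⟩⟩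
  · rintro ⟨w, h, h'⟩
    obtain ⟨z, hz, ha⟩ := A.act_mul.1 h
    obtain ⟨z', hz', hb⟩ := A.act_mul.1 h'
    obtain rfl := A.act_unique hz hz'
    exact ⟨z, ha, hb⟩

theorem straightLeftOrderExtension_embed (A : IsInversePair lel ler) :
    StraightLeftOrderExtension lel ler A.Quotients A.embed := by
  refine ⟨fun c d h => A.act_faithful (congrArg Subtype.val h), A.embed_mul, ?_, ?_,
    fun b c => ⟨A.lel_iff b c, A.ler_iff b c⟩⟩
  · rintro ⟨_, a, b, hab, rfl⟩
    obtain ⟨c, hc, d, hcd, e⟩ := A.exists_quot_eq hab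
    exact ⟨c, d, ⟨_, A.isGroupInverse_inv_embed hc, Subtype.ext e⟩,
      (A.ler_iff c d).1 hcd.1, (A.ler_iff d c).1 hcd.2⟩
  · intro a ha
    have ha' : a ∈ GS lel ler := A.gi ▸ (show a ∈ SqSet S from ha)
    exact ⟨_, A.isGroupInverse_inv_embed ha'⟩

end IsInversePair

end StarPairCalculus

section InverseSemigroup

variable [Semigroup Q]

theorem leL.trans {p q r : Q} (h : leL p q) (k : leL q r) : leL p r := by
  rcases h with rfl | ⟨x, rfl⟩
  · exact k
  · rcases k with rfl | ⟨y, rfl⟩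
    · exact Or.inr ⟨x, rfl⟩
    · exact Or.inr ⟨x * y, (mul_assoc _ _ _).symm⟩

theorem leR.trans {p q r : Q} (h : leR p q) (k : leR q r) : leR p r := by
  rcases h with rfl | ⟨x, rfl⟩
  · exact k
  · rcases k with rfl | ⟨y, rfl⟩
    · exact Or.inr ⟨x, rfl⟩
    · exact Or.inr ⟨y * x, mul_assoc _ _ _⟩

namespace IsGroupInverse

theorem mul_idem {q h : Q} (H : IsGroupInverse q h) : q * h * (q * h) = q * h := by
  rw [← mul_assoc, H.2.1]

theorem exists_of_leL {p q h : Q} (H : IsGroupInverse q h) (k : leL p q) : ∃ x, p = x * q :=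
  k.elim (fun e => ⟨q * h, by rw [H.2.1, e]⟩) id

theorem exists_of_leR {p q h : Q} (H : IsGroupInverse q h) (k : leR p q) : ∃ x, p = q * x :=
  k.elim (fun e => ⟨h * q, by rw [← mul_assoc, H.2.1, e]⟩) id

theorem mul_of_leL {p q h : Q} (H : IsGroupInverse q h) (k : leL p q) : p * (q * h) = p := by
  obtain ⟨x, rfl⟩ := H.exists_of_leL k
  rw [mul_assoc, H.1, ← mul_assoc q, H.2.1]

theorem mul_of_leR {p q h : Q} (H : IsGroupInverse q h) (k : leR p q) : q * h * p = p := by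
  obtain ⟨x, rfl⟩ := H.exists_of_leR k
  rw [← mul_assoc, H.2.1]

theorem leL_self {q h : Q} (H : IsGroupInverse q h) : leL (q * h) q := Or.inr ⟨h, H.1⟩

theorem leR_self {q h : Q} (_ : IsGroupInverse q h) : leR (q * h) q := Or.inr ⟨h, rfl⟩

end IsGroupInverse

/-- In an inverse semigroup, an idempotent is its only inverse. -/
theorem InverseSemigroup.idem_eq (hQ : InverseSemigroup Q) {e f : Q} (he : e * e = e)
    (h₁ : e * f * e = e) (h₂ : f * e * f = f) : e = f :=
  (hQ e).unique ⟨by rw [he, he], by rw [he, he]⟩ ⟨h₁, h₂⟩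

/-- In an inverse semigroup, `R`-related group elements have the same identity element. -/
theorem InverseSemigroup.one_eq_of_greenR (hQ : InverseSemigroup Q) {p q p' q' : Q}
    (hp : IsGroupInverse p p') (hq : IsGroupInverse q q') (h : GreenR p q) :
    p * p' = q * q' := by
  have h₁ := hq.mul_of_leR (hp.leR_self.trans h.1)
  have h₂ := hp.mul_of_leR (hq.leR_self.trans h.2)
  exact hQ.idem_eq hp.mul_idem (by rw [h₂, h₁]) (by rw [h₁, h₂])

/-- In an inverse semigroup, `L`-related group elements have the same identity element. -/
theorem InverseSemigroup.one_eq_of_greenL (hQ : InverseSemigroup Q) {p q p' q' : Q}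
    (hp : IsGroupInverse p p') (hq : IsGroupInverse q q') (h : GreenL p q) :
    p * p' = q * q' := by
  have h₁ := hq.mul_of_leL (hp.leL_self.trans h.1)
  have h₂ := hp.mul_of_leL (hq.leL_self.trans h.2)
  exact hQ.idem_eq hp.mul_idem (by rw [h₁, hp.mul_idem]) (by rw [h₂, hq.mul_idem])

theorem IsGroupInverse.greenH_of_one_eq {p q p' q' : Q} (hp : IsGroupInverse p p')
    (hq : IsGroupInverse q q') (h : p * p' = q * q') : GreenH p q := by
  refine ⟨⟨Or.inr ⟨p * q', ?_⟩, Or.inr ⟨q * p', ?_⟩⟩,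
    ⟨Or.inr ⟨q' * p, ?_⟩, Or.inr ⟨p' * q, ?_⟩⟩⟩
  · rw [mul_assoc, ← hq.1, ← h, hp.1, ← mul_assoc, hp.2.1]
  · rw [mul_assoc, ← hp.1, h, hq.1, ← mul_assoc, hq.2.1]
  · rw [← mul_assoc, ← h, hp.2.1]
  · rw [← mul_assoc, h, hq.2.1]

end InverseSemigroup

section Necessity

variable [Semigroup S] {lel ler : S → S → Prop} [Semigroup Q] {f : S → Q}

namespace StraightLeftOrderExtension

theorem lp_iff (X : StraightLeftOrderExtension lel ler Q f) {a b : S} :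
    Lp lel a b ↔ GreenL (f a) (f b) := and_congr (X.2.2.2.2 a b).1 (X.2.2.2.2 b a).1

theorem rp_iff (X : StraightLeftOrderExtension lel ler Q f) {a b : S} :
    Rp ler a b ↔ GreenR (f a) (f b) := and_congr (X.2.2.2.2 a b).2 (X.2.2.2.2 b a).2

theorem hp_iff (X : StraightLeftOrderExtension lel ler Q f) {a b : S} :
    Hp lel ler a b ↔ GreenH (f a) (f b) := and_congr X.lp_iff X.rp_iff

theorem mem_GS_of_inSubgroup (X : StraightLeftOrderExtension lel ler Q f) {a : S}
    (h : inSubgroup (f a)) : a ∈ GS lel ler := by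
  obtain ⟨c, hc⟩ := h
  refine X.hp_iff.2 ?_
  rw [X.2.1]
  refine ⟨⟨Or.inr ⟨c, ?_⟩, Or.inr ⟨f a, rfl⟩⟩, ⟨Or.inr ⟨c, ?_⟩, Or.inr ⟨f a, rfl⟩⟩⟩
  · rw [← mul_assoc, ← hc.1, hc.2.1]
  · rw [mul_assoc, hc.1, ← mul_assoc, hc.2.1]

theorem condGi (X : StraightLeftOrderExtension lel ler Q f)
    (E : IsEmbeddableStarPair lel ler) : CondGi lel ler := by
  obtain ⟨-, -, -, -, -, -, hl, hr⟩ := E.1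
  exact Set.ext fun a => ⟨fun h => X.mem_GS_of_inSubgroup (X.2.2.2.1 a h), fun h =>
    ⟨hl _ _ h.1.1, hl _ _ h.1.2, hr _ _ h.2.1, hr _ _ h.2.2⟩⟩

theorem inSubgroup_of_mem_GS (X : StraightLeftOrderExtension lel ler Q f)
    (E : IsEmbeddableStarPair lel ler) {a : S} (ha : a ∈ GS lel ler) : inSubgroup (f a) :=
  X.2.2.2.1 a (show a ∈ SqSet S from (X.condGi E).symm ▸ ha)

theorem condI (X : StraightLeftOrderExtension lel ler Q f)
    (E : IsEmbeddableStarPair lel ler) (hQ : InverseSemigroup Q) : CondI lel ler := by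
  intro a ha h hh
  obtain ⟨a', ha'⟩ := X.inSubgroup_of_mem_GS E ha
  obtain ⟨h', hh'⟩ := X.inSubgroup_of_mem_GS E hh
  exact ⟨fun k => X.hp_iff.2 (ha'.greenH_of_one_eq hh'
      (hQ.one_eq_of_greenR ha' hh' (X.rp_iff.1 k))),
    fun k => X.hp_iff.2 (ha'.greenH_of_one_eq hh'
      (hQ.one_eq_of_greenL ha' hh' (X.lp_iff.1 k)))⟩

theorem condGii (X : StraightLeftOrderExtension lel ler Q f)
    (E : IsEmbeddableStarPair lel ler) (hQ : InverseSemigroup Q) : CondGii lel ler := by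
  intro a ha x y hx hy
  have haG : a ∈ GS lel ler := X.condGi E ▸ ha
  obtain ⟨y', hy'⟩ := X.inSubgroup_of_mem_GS E (E.mem_GS_of_hp haG hy)
  obtain ⟨c, d, ⟨c', hc', e⟩, hcd⟩ := X.2.2.1 (f x * y')
  have hxy : f x * (f y * y') = f x :=
    hy'.mul_of_leL (X.lp_iff.1 (E.lp_trans hx.1 hy.1.symm)).1
  have hcG : c ∈ GS lel ler := X.mem_GS_of_inSubgroup ⟨c', hc'⟩
  have hd : f d = f c * f x * y' := by
    rw [mul_assoc, e, ← mul_assoc, hc'.mul_of_leR hcd.2]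
  have hdy : c * x = d * y := X.1 (by
    rw [X.2.1, X.2.1, hd, mul_assoc, mul_assoc, ← hy'.1, hxy])
  have hxc : leR (f x) (f c) := by
    obtain ⟨w, hw⟩ := hc'.exists_of_leR hcd.2
    refine Or.inr ⟨c' * w * f y, ?_⟩
    rw [← hxy, hy'.1, ← mul_assoc, e, hw]
    simp only [← mul_assoc]
    rw [hc'.1]
  have hcx : leR (f c) (f x) := by
    refine leR.trans (q := f x * y') ?_ (Or.inr ⟨y', rfl⟩)
    rw [e]
    rcases hcd.1 with h | ⟨w, hw⟩
    · refine Or.inr ⟨f c, ?_⟩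
      rw [← h, ← hc'.1, hc'.2.1]
    · refine Or.inr ⟨w * f c, ?_⟩
      rw [← mul_assoc, mul_assoc c', ← hw, ← hc'.1, hc'.2.1]
  have hca : Hp lel ler c a := (X.condI E hQ c hcG a haG).1
    (E.rp_trans (X.rp_iff.2 ⟨hcx, hxc⟩) hx.2)
  have hcxa := E.hp_mul haG hca hx
  refine ⟨c, d, hca, ⟨?_, E.rp_trans (X.rp_iff.2 hcd).symm hca.2⟩, hdy⟩
  refine E.lp_trans (X.lp_iff.2 ⟨?_, ?_⟩) hy.1
  · refine Or.inr ⟨f c * f x * y' * y', ?_⟩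
    rw [mul_assoc _ y' (f y), ← hy'.1, mul_assoc, ← mul_assoc y', ← hy'.1, hd]
    rw [hy'.1, hy'.2.2]
  · have k := (X.lp_iff.1 (E.lp_trans hcxa.1 hy.1.symm)).2
    rw [X.2.1] at k
    rcases k with k | ⟨z, hz⟩
    · refine Or.inr ⟨f y, ?_⟩
      rw [hd, ← k, hy'.1, ← mul_assoc, hy'.2.1]
    · refine Or.inr ⟨f y * z, ?_⟩
      rw [hd, mul_assoc, ← mul_assoc z, ← hz, hy'.1, ← mul_assoc, hy'.2.1]

end StraightLeftOrderExtension

end Necessity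

/-- Corollary 5.1: let `S` be a semigroup having an embeddable `*`-pair `(lel, ler)`.
Then there is an inverse semigroup `Q` containing `S` as a subsemigroup such that `S`
is a straight left order in `Q` and `Q` induces `(lel, ler)`, if and only if
`(lel, ler)` satisfies (Gi), (Gii) and (I). -/
theorem straight_left_order_inverse_iff {S : Type u} [Semigroup S]
    (lel ler : S → S → Prop) (hemb : IsEmbeddableStarPair lel ler) :
    (∃ (Q : Type u) (iQ : Semigroup Q) (f : S → Q),
      @InverseSemigroup Q iQ ∧ @StraightLeftOrderExtension S _ lel ler Q iQ f) ↔
    (CondGi lel ler ∧ CondGii lel ler ∧ CondI lel ler) := by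
  constructor
  · rintro ⟨Q, iQ, f, hQ, X⟩
    exact ⟨X.condGi hemb, X.condGii hemb hQ, X.condI hemb hQ⟩
  · rintro ⟨gi, gii, i⟩
    let A : IsInversePair lel ler := ⟨hemb, gi, gii, i⟩
    exact ⟨A.Quotients, inferInstance, A.embed, A.inverseSemigroup_quotients,
      A.straightLeftOrderExtension_embed⟩
end
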